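/- arXiv:math/9805034 — 2 statements merged into one kernel-verified Lean document; each statement's English description precedes it below -/
import Mathlib

section
/- Let m ≥ 2 and L = sl(m|1), acting on V via ρ (the realization of the simple L-module with highest weight −ε_m + ε_{m+1}). Then H²(L,V) = 0: every 2-cocycle of L with coefficients in V is a 2-coboundary. -/
open ExteriorAlgebra

open Matrix

variable (K : Type) [Field K]

/-- The space of matrices underlying `gl(m|n)`. -/
abbrev gl (m n : ℕ) : Type := Matrix (Fin (m + n)) (Fin (m + n)) K

/-- The parity of an index: indices `< m` are even, the rest odd. -/
def par (m n : ℕ) (i : Fin (m + n)) : ZMod 2 := if (i : ℕ) < m then 0 else 1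

/-- `A` is homogeneous of parity `p`. -/
def IsHom {m n : ℕ} (p : ZMod 2) (A : gl K m n) : Prop :=
  ∀ i j, A i j ≠ 0 → par m n i + par m n j = p

/-- The sign `(-1)^p` for `p : ZMod 2`. -/
def sg (p : ZMod 2) : K := if p = 0 then 1 else -1

/-- The even (block-diagonal) part of a matrix. -/
def evenP {m n : ℕ} (A : gl K m n) : gl K m n :=
  Matrix.of fun i j => if par m n i = par m n j then A i j else 0

/-- The odd (block-off-diagonal) part of a matrix. -/
def oddP {m n : ℕ} (A : gl K m n) : gl K m n :=
  Matrix.of fun i j => if par m n i = par m n j then 0 else A i j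

/-- The super bracket `⟨A,B⟩ = AB - (-1)^{|A||B|} BA` on homogeneous elements,
extended bilinearly to all of `gl(m|n)`. -/
def sbr {m n : ℕ} (A B : gl K m n) : gl K m n :=
  A * B - evenP K B * A - oddP K B * evenP K A + oddP K B * oddP K A

/-- The supertrace `Str(A) = Tr(a) - Tr(d)`. -/
def str {m n : ℕ} (A : gl K m n) : K := ∑ i, sg K (par m n i) * A i i

/-- `sl(m|n)`, the subspace of supertraceless matrices, as a submodule of `gl(m|n)`. -/
def sl (m n : ℕ) : Submodule K (gl K m n) where
  carrier := {A | str K A = 0}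
  add_mem' {A B} hA hB := by
    simp only [Set.mem_setOf_eq, str] at *
    simp [Matrix.add_apply, mul_add, Finset.sum_add_distrib, hA, hB]
  zero_mem' := by simp [str]
  smul_mem' c A hA := by
    simp only [Set.mem_setOf_eq, str] at *
    simp only [Matrix.smul_apply, smul_eq_mul, mul_left_comm, ← Finset.mul_sum, hA, mul_zero]

/-- The exterior algebra `Λ(E)` over `E = 𝕂^m`. -/
abbrev ExtAlg (m : ℕ) : Type := ExteriorAlgebra K (Fin m → K)

/-- The ambient space carrying `V = ⊕_{r=1}^m V_r`: an `m`-tuple of elements of `Λ(E)`,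
the component indexed by `r : Fin m` standing for the piece `V_{r+1} = ⋀^{m-1-r} E`. -/
abbrev Wam (m : ℕ) : Type := Fin m → ExtAlg K m

/-- Left exterior multiplication `ω ↦ v ∧ ω` by a vector `v ∈ E`. -/
def wmul {m : ℕ} (v : Fin m → K) : ExtAlg K m →ₗ[K] ExtAlg K m :=
  LinearMap.mulLeft K (ExteriorAlgebra.ι K v)

/-- Contraction (interior product) `ι_y` by a covector `y ∈ E*`. -/
def ctr {m : ℕ} (y : Module.Dual K (Fin m → K)) : ExtAlg K m →ₗ[K] ExtAlg K m :=
  CliffordAlgebra.contractLeft y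

/-- The derivation action `θ_a` of a matrix `a ∈ M_m(𝕂)` on the exterior algebra,
`θ_a (v₁ ∧ … ∧ v_k) = Σᵢ v₁ ∧ … ∧ (a vᵢ) ∧ … ∧ v_k`; concretely
`θ_a = Σ_{i,j} a_{ij} (e_i ∧ -) ∘ ι_{e_j*}`. -/
def theta {m : ℕ} (a : Matrix (Fin m) (Fin m) K) : ExtAlg K m →ₗ[K] ExtAlg K m :=
  ∑ i, ∑ j, a i j • (wmul K (Pi.single i 1) ∘ₗ ctr K (LinearMap.proj j))

/-- The upper-left `m×m` block `a` of `A ∈ gl(m|1)`. -/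
def blka {m : ℕ} (A : gl K m 1) : Matrix (Fin m) (Fin m) K :=
  Matrix.of fun i j => A (Fin.castSucc i) (Fin.castSucc j)

/-- The upper-right column `x` of `A ∈ gl(m|1)`. -/
def blkx {m : ℕ} (A : gl K m 1) : Fin m → K :=
  fun i => A (Fin.castSucc i) (Fin.last m)

/-- The lower-left row `y` of `A ∈ gl(m|1)`, as a covector. -/
def blky {m : ℕ} (A : gl K m 1) : Module.Dual K (Fin m → K) :=
  ∑ j, A (Fin.last m) (Fin.castSucc j) • (LinearMap.proj j :  (Fin m → K) →ₗ[K] K)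

/-- The lower-right entry `d` of `A ∈ gl(m|1)`. -/
def blkd {m : ℕ} (A : gl K m 1) : K := A (Fin.last m) (Fin.last m)

/-- Component `r` of the action `ρ(A)` on `V = ⊕_{r=1}^m V_r` (slot `r` standing for
`V_{r+1}`, `r = 0, …, m-1`): on `ω ∈ V_r` (paper numbering `r = 1, …, m`) it is
`θ_a ω - (Tr a) ω + r d ω` into `V_r`, plus `(r-1)(x ∧ ω)` into `V_{r-1}`, plus
`ι_y ω` into `V_{r+1}`. -/
def rhoComp {m : ℕ} (A : gl K m 1) (r : Fin m) : Wam K m →ₗ[K] ExtAlg K m :=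
  (theta K (blka K A) - (Matrix.trace (blka K A)) • LinearMap.id
      + ((((r : ℕ) + 1 : ℕ) : K) * blkd K A) • LinearMap.id) ∘ₗ LinearMap.proj r
    + (if h : (r : ℕ) + 1 < m then
        ((((r : ℕ) + 1 : ℕ) : K) • (wmul K (blkx K A) ∘ₗ LinearMap.proj (⟨(r : ℕ) + 1, h⟩ : Fin m)))
      else 0)
    + (if _h : 0 < (r : ℕ) then
        (ctr K (blky K A) ∘ₗ
          LinearMap.proj (⟨(r : ℕ) - 1, lt_of_le_of_lt (Nat.sub_le _ 1) r.isLt⟩ : Fin m))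
      else 0)

/-- The representation `ρ` of `gl(m|1)` on (the ambient space of) `V`. -/
def rho {m : ℕ} (A : gl K m 1) : Wam K m →ₗ[K] Wam K m :=
  LinearMap.pi (rhoComp K A)

/-- The submodule `V = ⊕_{r=1}^m V_r` with `V_r = ⋀^{m-r} E`. -/
def Vsub (m : ℕ) : Submodule K (Wam K m) :=
  Submodule.pi Set.univ fun r => ⋀[K]^(m - 1 - (r : ℕ)) (Fin m → K)

/-- The parity-`p` part of `V`: the sum of those `V_r` with `(m - r) % 2 = p`. -/
def Vpart (m : ℕ) (p : ZMod 2) : Submodule K (Wam K m) :=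
  Submodule.pi Set.univ fun r =>
    if ((m - 1 - (r : ℕ) : ℕ) : ZMod 2) = p then ⋀[K]^(m - 1 - (r : ℕ)) (Fin m → K) else ⊥

/-- The top wedge `e₁ ∧ e₂ ∧ … ∧ e_m ∈ ⋀^m E`. -/
def topWedge (m : ℕ) : ExtAlg K m :=
  (List.ofFn fun i : Fin m => ExteriorAlgebra.ι K (Pi.single i (1 : K))).prod

/-- `η_k = ι_{e_k*}(e₁ ∧ … ∧ e_m) ∈ ⋀^{m-1} E`. -/
def eta {m : ℕ} (k : Fin m) : ExtAlg K m :=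
  ctr K (LinearMap.proj k) (topWedge K m)

section Exterior

variable {m : ℕ}

theorem ctr_wmul (y : Module.Dual K (Fin m → K)) (v : Fin m → K) (w : ExtAlg K m) :
    ctr K y (wmul K v w) = y v • w - wmul K v (ctr K y w) :=
  CliffordAlgebra.contractLeft_ι_mul ..

theorem wmul_wmul_self (v : Fin m → K) (w : ExtAlg K m) : wmul K v (wmul K v w) = 0 := by
  simp [wmul, ← mul_assoc]

theorem wmul_add_left (u v : Fin m → K) : wmul K (u + v) = wmul K u + wmul K v := by
  ext; simp [wmul, add_mul]

theorem wmul_eq_sum (v : Fin m → K) (w : ExtAlg K m) :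
    wmul K v w = ∑ i, v i • wmul K (Pi.single i 1) w := by
  conv_lhs => rw [← Finset.univ_sum_single v]
  simp only [wmul, map_sum, LinearMap.mulLeft_apply, Finset.sum_mul]
  refine Finset.sum_congr rfl fun i _ => ?_
  rw [← smul_mul_assoc, ← map_smul, ← Pi.single_smul, smul_eq_mul, mul_one]

theorem wmul_anticomm (u v : Fin m → K) (w : ExtAlg K m) :
    wmul K u (wmul K v w) = -wmul K v (wmul K u w) := by
  rw [eq_neg_iff_add_eq_zero]
  have h := ExteriorAlgebra.ι_add_mul_swap (R := K) u v
  simp only [wmul, LinearMap.mulLeft_apply, ← mul_assoc, ← add_mul, h, zero_mul]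

theorem theta_apply (a : Matrix (Fin m) (Fin m) K) (w : ExtAlg K m) :
    theta K a w = ∑ i, ∑ j, a i j • wmul K (Pi.single i 1) (ctr K (LinearMap.proj j) w) := by
  simp [theta, LinearMap.sum_apply]

theorem theta_add (a b : Matrix (Fin m) (Fin m) K) : theta K (a + b) = theta K a + theta K b := by
  ext; simp [theta_apply, add_smul, Finset.sum_add_distrib]

theorem theta_smul (c : K) (a : Matrix (Fin m) (Fin m) K) : theta K (c • a) = c • theta K a := by
  ext; simp [theta_apply, mul_smul, Finset.smul_sum]

theorem theta_wmul (a : Matrix (Fin m) (Fin m) K) (v : Fin m → K) (w : ExtAlg K m) :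
    theta K a (wmul K v w) = wmul K (a *ᵥ v) w + wmul K v (theta K a w) := by
  simp only [theta_apply, ctr_wmul, map_sub, map_smul, smul_sub, map_sum]
  simp only [wmul_anticomm K v, smul_neg, Finset.sum_neg_distrib, sub_eq_add_neg,
    Finset.sum_add_distrib, wmul_eq_sum K (a *ᵥ v), Matrix.mulVec, dotProduct, Finset.sum_smul,
    smul_smul, LinearMap.proj_apply]

theorem wmul_mem {k : ℕ} (v : Fin m → K) {w : ExtAlg K m} (hw : w ∈ ⋀[K]^k (Fin m → K)) :
    wmul K v w ∈ ⋀[K]^(k + 1) (Fin m → K) := by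
  rw [ExteriorAlgebra.exteriorPower, pow_succ']
  exact Submodule.mul_mem_mul ⟨v, rfl⟩ hw

theorem ctr_zero_degree (y : Module.Dual K (Fin m → K)) {w : ExtAlg K m}
    (hw : w ∈ ⋀[K]^0 (Fin m → K)) : ctr K y w = 0 := by
  rw [ExteriorAlgebra.exteriorPower, pow_zero, Submodule.mem_one] at hw
  obtain ⟨c, rfl⟩ := hw
  exact CliffordAlgebra.contractLeft_algebraMap _ _ c

/-- An element of the exterior power of degree `k + 1` is a sum of products `v ∧ w`. -/
theorem exteriorPower_succ_induction {k : ℕ} {P : ExtAlg K m → Prop}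
    (hadd : ∀ x y, P x → P y → P (x + y))
    (hmul : ∀ v, ∀ w ∈ ⋀[K]^k (Fin m → K), P (wmul K v w)) {w : ExtAlg K m}
    (hw : w ∈ ⋀[K]^(k + 1) (Fin m → K)) : P w := by
  rw [ExteriorAlgebra.exteriorPower, pow_succ'] at hw
  refine Submodule.mul_induction_on hw ?_ hadd
  rintro _ ⟨v, rfl⟩ w hw
  exact hmul v w hw

theorem ctr_mem {k : ℕ} (y : Module.Dual K (Fin m → K)) {w : ExtAlg K m}
    (hw : w ∈ ⋀[K]^(k + 1) (Fin m → K)) : ctr K y w ∈ ⋀[K]^k (Fin m → K) := by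
  induction k generalizing w with
  | zero =>
    refine exteriorPower_succ_induction K (P := fun w => ctr K y w ∈ _) (fun _ _ h₁ h₂ => ?_)
      (fun v w hw => ?_) hw
    · rw [map_add]; exact add_mem h₁ h₂
    · rw [ctr_wmul, ctr_zero_degree K y hw, map_zero, sub_zero]
      exact Submodule.smul_mem _ _ hw
  | succ k ih =>
    refine exteriorPower_succ_induction K (P := fun w => ctr K y w ∈ _) (fun _ _ h₁ h₂ => ?_)
      (fun v w hw => ?_) hw
    · rw [map_add]; exact add_mem h₁ h₂
    · rw [ctr_wmul]
      exact sub_mem (Submodule.smul_mem _ _ hw) (wmul_mem K v (ih hw))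

theorem theta_one {k : ℕ} {w : ExtAlg K m} (hw : w ∈ ⋀[K]^k (Fin m → K)) :
    theta K 1 w = (k : K) • w := by
  induction k generalizing w with
  | zero => simp [theta_apply, ctr_zero_degree K _ hw]
  | succ k ih =>
    refine exteriorPower_succ_induction K (P := fun w => theta K 1 w = ((k + 1 : ℕ) : K) • w)
      (fun _ _ h₁ h₂ => ?_)
      (fun v w hw => ?_) hw
    · rw [map_add, h₁, h₂, smul_add]
    · rw [theta_wmul, ih hw, Matrix.one_mulVec, map_smul, Nat.cast_succ, add_smul, one_smul,
        add_comm]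

theorem theta_eq_sub (a : Matrix (Fin m) (Fin m) K) (w : ExtAlg K m) :
    theta K a w = a.trace • w
      - ∑ i, ∑ j, a i j • ctr K (LinearMap.proj j) (wmul K (Pi.single i 1) w) := by
  simp only [theta_apply, ctr_wmul, smul_sub, Finset.sum_sub_distrib, LinearMap.proj_apply,
    Pi.single_apply, ite_smul, one_smul, zero_smul, smul_ite, smul_zero, Finset.sum_ite_eq',
    Finset.mem_univ, if_true, Matrix.trace, Matrix.diag, Finset.sum_smul]
  simp

theorem eq_zero_of_wmul_eq_zero [CharZero K] {k : ℕ} (hk : k < m) {w : ExtAlg K m}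
    (hw : w ∈ ⋀[K]^k (Fin m → K)) (h : ∀ v, wmul K v w = 0) : w = 0 := by
  have h₁ := theta_eq_sub K 1 w
  rw [theta_one K hw] at h₁
  simp only [h, map_zero, smul_zero, Finset.sum_const_zero, sub_zero, Matrix.trace_one,
    Fintype.card_fin] at h₁
  rw [← sub_eq_zero, ← sub_smul, smul_eq_zero, sub_eq_zero, Nat.cast_inj] at h₁
  exact h₁.resolve_left hk.ne

theorem eq_zero_of_top_lt {w : ExtAlg K m} (hw : w ∈ ⋀[K]^(m + 1) (Fin m → K)) : w = 0 := by
  have h := exteriorPower.finrank_eq K (M := Fin m → K) (m + 1)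
  rw [Module.finrank_fin_fun, Nat.choose_succ_self, Module.finrank_zero_iff] at h
  exact congrArg Subtype.val (Subsingleton.elim (⟨w, hw⟩ : ⋀[K]^(m + 1) (Fin m → K)) 0)

theorem exists_volume : ∃ (vol : ExtAlg K m →ₗ[K] K) (W : ExtAlg K m),
    W ∈ ⋀[K]^m (Fin m → K) ∧ vol W = 1 ∧ ∀ w ∈ ⋀[K]^m (Fin m → K), w = vol w • W := by
  have h := exteriorPower.finrank_eq K (M := Fin m → K) m
  rw [Module.finrank_fin_fun, Nat.choose_self, finrank_eq_one_iff'] at h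
  obtain ⟨W, hW0, hW⟩ := h
  have hW0' : (W : ExtAlg K m) ≠ 0 := fun h => hW0 (Subtype.ext h)
  obtain ⟨vol, hvol⟩ := Module.Projective.exists_dual_eq_one K hW0'
  refine ⟨vol, W, W.2, hvol, fun w hw => ?_⟩
  obtain ⟨c, hc⟩ := hW ⟨w, hw⟩
  obtain rfl : c • (W : ExtAlg K m) = w := congrArg Subtype.val hc
  rw [map_smul, hvol, smul_eq_mul, mul_one]

theorem theta_top (a : Matrix (Fin m) (Fin m) K) {w : ExtAlg K m}
    (hw : w ∈ ⋀[K]^m (Fin m → K)) : theta K a w = a.trace • w := by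
  simp [theta_eq_sub, eq_zero_of_top_lt K (wmul_mem K _ hw)]

end Exterior

section Derivation

variable {m : ℕ}

theorem sum_single_casimir_left {N : Type*} [AddCommGroup N] [Module K N]
    (B : Matrix (Fin m) (Fin m) K →ₗ[K] Matrix (Fin m) (Fin m) K →ₗ[K] N)
    (a : Matrix (Fin m) (Fin m) K) :
    ∑ i, ∑ j, B (a * Matrix.single i j 1) (Matrix.single j i 1)
      = ∑ i, ∑ j, B (Matrix.single i j 1) (Matrix.single j i 1 * a) := by
  have h₁ (i j : Fin m) : a * Matrix.single i j (1 : K) = ∑ k, a k i • Matrix.single k j 1 := by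
    ext p q
    simp [Matrix.mul_apply, Matrix.single_apply, Matrix.sum_apply, ite_and]
  have h₂ (i j : Fin m) : Matrix.single j i (1 : K) * a = ∑ k, a i k • Matrix.single j k 1 := by
    ext p q
    simp [Matrix.mul_apply, Matrix.single_apply, Matrix.sum_apply, ite_and]
  simp only [h₁, h₂, map_sum, map_smul, LinearMap.sum_apply, LinearMap.smul_apply]
  calc _ = ∑ i, ∑ k, ∑ j, a k i • B (Matrix.single k j 1) (Matrix.single j i 1) :=
        Finset.sum_congr rfl fun i _ => Finset.sum_comm
    _ = ∑ k, ∑ i, ∑ j, a k i • B (Matrix.single k j 1) (Matrix.single j i 1) := Finset.sum_comm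
    _ = _ := Finset.sum_congr rfl fun i _ => Finset.sum_comm

theorem sum_single_casimir_right {N : Type*} [AddCommGroup N] [Module K N]
    (B : Matrix (Fin m) (Fin m) K →ₗ[K] Matrix (Fin m) (Fin m) K →ₗ[K] N)
    (a : Matrix (Fin m) (Fin m) K) :
    ∑ i, ∑ j, B (Matrix.single i j 1 * a) (Matrix.single j i 1)
      = ∑ i, ∑ j, B (Matrix.single i j 1) (a * Matrix.single j i 1) := by
  have h := sum_single_casimir_left K B.flip a
  simp only [LinearMap.flip_apply] at h
  rw [Finset.sum_comm, ← h, Finset.sum_comm]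

/-- The Lie bracket of matrices, as a bilinear map. -/
def commutatorBilin : Matrix (Fin m) (Fin m) K →ₗ[K] Matrix (Fin m) (Fin m) K →ₗ[K]
    Matrix (Fin m) (Fin m) K :=
  LinearMap.mul K _ - (LinearMap.mul K _).flip

theorem commutatorBilin_apply (a b : Matrix (Fin m) (Fin m) K) :
    commutatorBilin K a b = a * b - b * a := by
  simp [commutatorBilin]

theorem sum_commutator_commutator (X : Matrix (Fin m) (Fin m) K) :
    ∑ i, ∑ j, commutatorBilin K (Matrix.single i j 1)
        (commutatorBilin K (Matrix.single j i 1) X)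
      = (2 * m : K) • X - (2 * X.trace) • 1 := by
  have h₁ : ∑ i : Fin m, ∑ j : Fin m, Matrix.single i j (1 : K) * Matrix.single j i 1
      = (m : K) • 1 := by
    ext p q
    simp [Matrix.sum_apply, Matrix.single_apply, Matrix.one_apply, ite_and]
  have h₂ : ∑ i : Fin m, ∑ j : Fin m, Matrix.single i j (1 : K) * X * Matrix.single j i 1
      = X.trace • 1 := by
    ext p q
    simp [Matrix.sum_apply, Matrix.single_apply, Matrix.one_apply, ite_and, Matrix.trace]
  have h₃ : ∑ i : Fin m, ∑ j : Fin m, Matrix.single j i (1 : K) * Matrix.single i j 1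
      = (m : K) • 1 := by rw [Finset.sum_comm, h₁]
  have h₄ : ∑ i : Fin m, ∑ j : Fin m, Matrix.single j i (1 : K) * X * Matrix.single i j 1
      = X.trace • 1 := by rw [Finset.sum_comm, h₂]
  calc _ = (∑ i : Fin m, ∑ j : Fin m, Matrix.single i j (1 : K) * Matrix.single j i 1) * X
        + X * (∑ i : Fin m, ∑ j : Fin m, Matrix.single j i (1 : K) * Matrix.single i j 1)
        - (∑ i : Fin m, ∑ j : Fin m, Matrix.single i j (1 : K) * X * Matrix.single j i 1)
        - (∑ i : Fin m, ∑ j : Fin m, Matrix.single j i (1 : K) * X * Matrix.single i j 1) := by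
        simp only [Finset.sum_mul, Finset.mul_sum, ← Finset.sum_add_distrib,
          ← Finset.sum_sub_distrib, commutatorBilin_apply]
        refine Finset.sum_congr rfl fun i _ => Finset.sum_congr rfl fun j _ => ?_
        noncomm_ring
    _ = _ := by
        rw [h₁, h₂, h₃, h₄]
        simp only [smul_mul_assoc, mul_smul_comm, one_mul, mul_one, two_mul, add_smul]
        abel

/-- A Lie derivation of `gl_m` pairing trivially with rank one matrices is inner. -/
theorem derivation_inner [CharZero K] (hm : 0 < m)
    (D : Matrix (Fin m) (Fin m) K →ₗ[K] Matrix (Fin m) (Fin m) K)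
    (hD : ∀ a b, D (a * b - b * a) = (a * D b - D b * a) + (D a * b - b * D a))
    (hQ : ∀ x y, Matrix.trace (Matrix.vecMulVec x y * D (Matrix.vecMulVec x y)) = 0) :
    ∃ M, ∀ a, D a = a * M - M * a := by
  set v := ∑ i, ∑ j, commutatorBilin K (Matrix.single i j 1) (D (Matrix.single j i 1)) with hv
  have hm' : (m : K) ≠ 0 := Nat.cast_ne_zero.2 hm.ne'
  have key (a) : a * v - v * a = (2 * m : K) • D a - (2 * (D a).trace) • 1 := by
    rw [← sum_commutator_commutator, ← commutatorBilin_apply, hv]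
    have h₁ := sum_single_casimir_left K ((commutatorBilin K).compl₂ D) a
    have h₂ := sum_single_casimir_right K ((commutatorBilin K).compl₂ D) a
    simp only [LinearMap.compl₂_apply] at h₁ h₂
    have h₃ (i j : Fin m) : commutatorBilin K a
        (commutatorBilin K (Matrix.single i j 1) (D (Matrix.single j i 1)))
        = commutatorBilin K (Matrix.single i j 1) (commutatorBilin K (Matrix.single j i 1) (D a))
        + commutatorBilin K (a * Matrix.single i j 1) (D (Matrix.single j i 1))
        - commutatorBilin K (Matrix.single i j 1 * a) (D (Matrix.single j i 1))
        + commutatorBilin K (Matrix.single i j 1) (D (a * Matrix.single j i 1))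
        - commutatorBilin K (Matrix.single i j 1) (D (Matrix.single j i 1 * a)) := by
      have h := hD a (Matrix.single j i 1)
      rw [map_sub, sub_eq_iff_eq_add] at h
      rw [h]
      simp only [commutatorBilin_apply]
      noncomm_ring
    simp only [map_sum, h₃, Finset.sum_add_distrib, Finset.sum_sub_distrib, h₁, h₂]
    abel
  have hDa (a) : D a = (2 * m : K)⁻¹ • (a * v - v * a) + ((D a).trace / m) • 1 := by
    rw [key, smul_sub, smul_smul, smul_smul, inv_mul_cancel₀ (by simpa using hm'), one_smul]
    rw [show (2 * m : K)⁻¹ * (2 * (D a).trace) = (D a).trace / m by field_simp, sub_add_cancel]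
  have hrank (x y : Fin m → K) (h : Matrix.trace (Matrix.vecMulVec x y) = 1) :
      (D (Matrix.vecMulVec x y)).trace = 0 := by
    have h₁ := hQ x y
    rw [hDa, mul_add, mul_smul_comm, mul_smul_comm, mul_one, Matrix.trace_add, Matrix.trace_smul,
      Matrix.trace_smul, mul_sub, Matrix.trace_sub,
      Matrix.trace_mul_comm _ (v * _), Matrix.mul_assoc v, ← Matrix.mul_assoc,
      Matrix.trace_mul_comm (_ * _) v, sub_self, h] at h₁
    simpa [hm'] using h₁
  have htrace (a) : (D a).trace = 0 := by
    have hs (i : Fin m) : (D (Matrix.single i i 1)).trace = 0 := by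
      have h := hrank (Pi.single i 1) (Pi.single i 1)
      rw [← Matrix.single_eq_single_vecMulVec_single] at h
      exact h (by simp)
    have : Matrix.traceLinearMap (Fin m) K K ∘ₗ D = 0 := by
      refine Matrix.ext_linearMap _ fun i j => LinearMap.ext_ring ?_
      change (D (Matrix.single i j 1)).trace = 0
      by_cases hij : i = j
      · exact hij ▸ hs i
      · have h := hrank (Pi.single i 1) (Pi.single i 1 + Pi.single j 1)
        rw [Matrix.vecMulVec_add, ← Matrix.single_eq_single_vecMulVec_single,
          ← Matrix.single_eq_single_vecMulVec_single, map_add, Matrix.trace_add,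
          Matrix.trace_add, hs, zero_add] at h
        exact h (by simp [Matrix.trace_single_eq_of_ne _ _ _ hij])
    exact LinearMap.congr_fun this a
  refine ⟨(2 * m : K)⁻¹ • v, fun a => ?_⟩
  rw [hDa, htrace, zero_div, zero_smul, add_zero, mul_smul_comm, smul_mul_assoc, smul_sub]

end Derivation

section LeviCocycle

variable {m : ℕ}

/-- The action of `gl_m`, embedded in `sl(m|1)`, on the rows spanning the degree one part. -/
def rowAct (a : Matrix (Fin m) (Fin m) K) (y : Fin m → K) : Fin m → K :=
  a.trace • y - y ᵥ* a

theorem theta_mem {k : ℕ} (a : Matrix (Fin m) (Fin m) K) {w : ExtAlg K m}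
    (hw : w ∈ ⋀[K]^k (Fin m → K)) : theta K a w ∈ ⋀[K]^k (Fin m → K) := by
  rw [theta_apply]
  refine sum_mem fun i _ => sum_mem fun j _ => Submodule.smul_mem _ _ ?_
  cases k with
  | zero => simp [ctr_zero_degree K _ hw]
  | succ k => exact wmul_mem K _ (ctr_mem K _ hw)

theorem levi_cocycle_inner [CharZero K] (hm : 0 < m)
    (α : Matrix (Fin m) (Fin m) K →ₗ[K] (Fin m → K) →ₗ[K] ExtAlg K m)
    (hmem : ∀ a y, α a y ∈ ⋀[K]^(m - 1) (Fin m → K))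
    (hcoc : ∀ a b y, theta K a (α b y) - theta K b (α a y) - α (a * b - b * a) y
      - α b (rowAct K a y) + α a (rowAct K b y) = 0)
    (hQ : ∀ x y, wmul K x (α (Matrix.vecMulVec x y) y) = 0) :
    ∃ T : (Fin m → K) →ₗ[K] ExtAlg K m, (∀ y, T y ∈ ⋀[K]^(m - 1) (Fin m → K)) ∧
      ∀ a y, α a y = theta K a (T y) - T (rowAct K a y) := by
  obtain ⟨vol, W, hW, hvolW, hvol⟩ := exists_volume K (m := m)
  have hm1 : m - 1 + 1 = m := Nat.sub_add_cancel hm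
  have hup {w : ExtAlg K m} (x : Fin m → K) (hw : w ∈ ⋀[K]^(m - 1) (Fin m → K)) :
      wmul K x w ∈ ⋀[K]^m (Fin m → K) := by
    have h := wmul_mem K x hw
    rwa [hm1] at h
  have hzero {w : ExtAlg K m} (hw : w ∈ ⋀[K]^(m - 1) (Fin m → K))
      (h : ∀ x, vol (wmul K x w) = 0) : w = 0 :=
    eq_zero_of_wmul_eq_zero K (Nat.sub_lt hm one_pos) hw fun x => by
      rw [hvol _ (hup x hw), h, zero_smul]
  have hact (a : Matrix (Fin m) (Fin m) K) (x : Fin m → K) {w : ExtAlg K m}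
      (hw : w ∈ ⋀[K]^(m - 1) (Fin m → K)) :
      vol (wmul K x (theta K a w)) = a.trace * vol (wmul K x w) - vol (wmul K (a *ᵥ x) w) := by
    have h := congrArg vol (theta_wmul K a x w)
    rw [theta_top K a (hup x hw), map_smul, map_add, smul_eq_mul] at h
    rw [h, add_sub_cancel_left]
  let D : Matrix (Fin m) (Fin m) K →ₗ[K] Matrix (Fin m) (Fin m) K :=
    { toFun := fun a => Matrix.of fun k i =>
        vol (wmul K (Pi.single i 1) (α a (Pi.single k 1)))
      map_add' := fun a b => by ext; simp
      map_smul' := fun c a => by ext; simp }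
  have hpair (a : Matrix (Fin m) (Fin m) K) (x y : Fin m → K) :
      vol (wmul K x (α a y)) = y ⬝ᵥ (D a *ᵥ x) := by
    have hy : α a y = ∑ k, y k • α a (Pi.single k 1) := by
      conv_lhs => rw [← Finset.univ_sum_single y]
      rw [map_sum]
      refine Finset.sum_congr rfl fun k _ => ?_
      rw [← map_smul, ← Pi.single_smul, smul_eq_mul, mul_one]
    rw [wmul_eq_sum, hy]
    simp only [map_sum, map_smul, smul_eq_mul, dotProduct, Matrix.mulVec, D, LinearMap.coe_mk,
      AddHom.coe_mk, Matrix.of_apply, Finset.mul_sum]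
    rw [Finset.sum_comm]
    exact Finset.sum_congr rfl fun k _ => Finset.sum_congr rfl fun i _ => by ring
  have hext {A B : Matrix (Fin m) (Fin m) K} (h : ∀ x y, y ⬝ᵥ (A *ᵥ x) = y ⬝ᵥ (B *ᵥ x)) :
      A = B := by
    ext k i
    simpa using h (Pi.single i 1) (Pi.single k 1)
  obtain ⟨M, hM⟩ := derivation_inner K hm D
    (fun a b => hext fun x y => by
      have h := congrArg (fun w => vol (wmul K x w)) (hcoc a b y)
      simp only [map_add, map_sub, map_zero, hact _ _ (hmem _ _), map_smul, LinearMap.sub_apply,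
        hpair,
        rowAct, ← Matrix.dotProduct_mulVec, Matrix.mulVec_mulVec, smul_eq_mul] at h
      simp only [Matrix.add_mulVec, Matrix.sub_mulVec, dotProduct_add, dotProduct_sub,
        map_sub] at h ⊢
      linear_combination -h)
    (fun x y => by
      have h := hpair (Matrix.vecMulVec x y) x y
      rw [hQ, map_zero] at h
      rw [Matrix.vecMulVec_mul, Matrix.trace_vecMulVec, dotProduct_comm,
        ← Matrix.dotProduct_mulVec, ← h])
  let T : (Fin m → K) →ₗ[K] ExtAlg K m :=
    ∑ l, (LinearMap.proj l ∘ₗ Matrix.vecMulLinear M).smulRight (ctr K (LinearMap.proj l) W)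
  have hT (y) : T y = ∑ l, (y ᵥ* M) l • ctr K (LinearMap.proj l) W := by
    simp [T, LinearMap.sum_apply]
  have hTmem (y) : T y ∈ ⋀[K]^(m - 1) (Fin m → K) := by
    rw [hT]
    exact sum_mem fun l _ => Submodule.smul_mem _ _ (ctr_mem K _ (by rwa [hm1]))
  have hTpair (x y : Fin m → K) : vol (wmul K x (T y)) = y ⬝ᵥ (M *ᵥ x) := by
    have h (l : Fin m) : wmul K x (ctr K (LinearMap.proj l) W) = x l • W := by
      have := ctr_wmul K (LinearMap.proj l) x W
      rw [eq_zero_of_top_lt K (wmul_mem K x hW), map_zero] at this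
      exact (sub_eq_zero.1 this.symm).symm
    rw [hT, Matrix.dotProduct_mulVec]
    simp only [map_sum, map_smul, h, hvolW, smul_eq_mul, mul_one, dotProduct]
  refine ⟨T, hTmem, fun a y => sub_eq_zero.1 <| hzero ?_ fun x => ?_⟩
  · exact sub_mem (hmem a y) (sub_mem (theta_mem K a (hTmem y)) (hTmem _))
  · simp only [map_sub, hact _ _ (hTmem _), hpair, hTpair, rowAct, hM,
      smul_dotProduct, ← Matrix.dotProduct_mulVec, Matrix.mulVec_mulVec, smul_eq_mul,
      Matrix.sub_mulVec, dotProduct_sub]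
    ring

end LeviCocycle

section Coordinates

variable {m : ℕ}

/-- Coordinates `(a, x, y)` on `sl(m|1)`; the last diagonal entry is the trace of `a`. -/
abbrev Coord (m : ℕ) : Type := Matrix (Fin m) (Fin m) K × (Fin m → K) × (Fin m → K)

/-- The matrix of `gl(m|1)` with blocks `a`, `x`, `y` and last entry `tr a`. -/
def coordMat (u : Coord K m) : gl K m 1 :=
  Matrix.of fun i j => Fin.lastCases (Fin.lastCases u.1.trace u.2.2 j)
    (fun i => Fin.lastCases (u.2.1 i) (u.1 i) j) i

@[simp] theorem coordMat_cc (u : Coord K m) (i j : Fin m) :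
    coordMat K u (Fin.castSucc i) (Fin.castSucc j) = u.1 i j := by
  simp [coordMat]

@[simp] theorem coordMat_cl (u : Coord K m) (i : Fin m) :
    coordMat K u (Fin.castSucc i) (Fin.last m) = u.2.1 i := by
  simp [coordMat]

@[simp] theorem coordMat_lc (u : Coord K m) (j : Fin m) :
    coordMat K u (Fin.last m) (Fin.castSucc j) = u.2.2 j := by
  simp [coordMat]

@[simp] theorem coordMat_ll (u : Coord K m) :
    coordMat K u (Fin.last m) (Fin.last m) = u.1.trace := by
  simp [coordMat]

@[simp] theorem par_castSucc (i : Fin m) : par m 1 (Fin.castSucc i) = 0 := by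
  simp [par]

@[simp] theorem par_last : par m 1 (Fin.last m) = 1 := by
  simp [par]

theorem gl_ext {R : Type} {A B : gl R m 1}
    (h₁ : ∀ i j : Fin m, A (Fin.castSucc i) (Fin.castSucc j) = B (Fin.castSucc i) (Fin.castSucc j))
    (h₂ : ∀ i : Fin m, A (Fin.castSucc i) (Fin.last m) = B (Fin.castSucc i) (Fin.last m))
    (h₃ : ∀ j : Fin m, A (Fin.last m) (Fin.castSucc j) = B (Fin.last m) (Fin.castSucc j))
    (h₄ : A (Fin.last m) (Fin.last m) = B (Fin.last m) (Fin.last m)) : A = B := by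
  ext i j
  induction i using Fin.lastCases <;> induction j using Fin.lastCases <;> simp_all

theorem str_eq (A : gl K m 1) : str K A = (blka K A).trace - blkd K A := by
  rw [str, Fin.sum_univ_castSucc]
  simp [sg, blka, blkd, Matrix.trace, sub_eq_add_neg]

/-- The linear parametrization of `sl(m|1)` by coordinates. -/
def ofCoord : Coord K m →ₗ[K] ↥(sl K m 1) where
  toFun u := ⟨coordMat K u, by
    change str K _ = 0
    rw [str_eq, sub_eq_zero]
    simp [blka, blkd, Matrix.trace]⟩
  map_add' u v := Subtype.ext <| gl_ext (by simp) (by simp) (by simp) (by simp)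
  map_smul' c u := Subtype.ext <| gl_ext (by simp) (by simp) (by simp) (by simp)

@[simp] theorem coe_ofCoord (u : Coord K m) : (ofCoord K u : gl K m 1) = coordMat K u := rfl

/-- The coordinates of an element of `sl(m|1)`. -/
def toCoord : ↥(sl K m 1) →ₗ[K] Coord K m where
  toFun A := (blka K A, blkx K A, fun j => A.1 (Fin.last m) (Fin.castSucc j))
  map_add' _ _ := rfl
  map_smul' _ _ := rfl

theorem toCoord_fst (A : ↥(sl K m 1)) (i j : Fin m) :
    (toCoord K A).1 i j = A.1 (Fin.castSucc i) (Fin.castSucc j) := rfl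

theorem toCoord_col (A : ↥(sl K m 1)) (i : Fin m) :
    (toCoord K A).2.1 i = A.1 (Fin.castSucc i) (Fin.last m) := rfl

theorem toCoord_row (A : ↥(sl K m 1)) (j : Fin m) :
    (toCoord K A).2.2 j = A.1 (Fin.last m) (Fin.castSucc j) := rfl

@[simp] theorem ofCoord_toCoord (A : ↥(sl K m 1)) : ofCoord K (toCoord K A) = A := by
  refine Subtype.ext <| gl_ext (by simp [toCoord_fst]) (by simp [toCoord_col])
    (by simp [toCoord_row]) ?_
  have h : str K (A : gl K m 1) = 0 := A.2
  rw [str_eq, sub_eq_zero] at h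
  rw [coe_ofCoord, coordMat_ll]
  exact h

@[simp] theorem toCoord_ofCoord (u : Coord K m) : toCoord K (ofCoord K u) = u := by
  refine Prod.ext (by ext; simp [toCoord_fst])
    (Prod.ext (by ext; simp [toCoord_col]) (by ext; simp [toCoord_row]))

/-- The super bracket of `sl(m|1)` in coordinates. -/
def coordBr (u v : Coord K m) : Coord K m :=
  (u.1 * v.1 - v.1 * u.1 + Matrix.vecMulVec u.2.1 v.2.2 + Matrix.vecMulVec v.2.1 u.2.2,
    (u.1 *ᵥ v.2.1 - u.1.trace • v.2.1) - (v.1 *ᵥ u.2.1 - v.1.trace • u.2.1),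
    rowAct K u.1 v.2.2 - rowAct K v.1 u.2.2)

theorem sbr_coordMat (u v : Coord K m) :
    sbr K (coordMat K u) (coordMat K v) = coordMat K (coordBr K u v) := by
  apply gl_ext
  · intro i j
    simp [sbr, evenP, oddP, coordBr, Matrix.mul_apply, Fin.sum_univ_castSucc,
      Matrix.vecMulVec_apply]
    ring
  · intro i
    simp [sbr, evenP, oddP, coordBr, Matrix.mul_apply, Fin.sum_univ_castSucc, Matrix.mulVec,
      dotProduct]
    ring
  · intro i
    simp [sbr, evenP, oddP, coordBr, Matrix.mul_apply, Fin.sum_univ_castSucc, rowAct,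
      Matrix.vecMul, dotProduct]
    ring
  · simp [sbr, evenP, oddP, coordBr, Matrix.mul_apply, Fin.sum_univ_castSucc,
      Matrix.trace_mul_comm v.1, Matrix.trace_vecMulVec, dotProduct, mul_comm,
      add_comm]

/-- Pure elements of `sl(m|1)`, with their parity and their weight for the grading element. -/
inductive IsPure : ZMod 2 → K → Coord K m → Prop
  | zero (a : Matrix (Fin m) (Fin m) K) : IsPure 0 0 (a, 0, 0)
  | up (y : Fin m → K) : IsPure 1 1 (0, 0, y)
  | down (x : Fin m → K) : IsPure 1 (-1) (0, x, 0)

/-- `u` has weight `c` for the grading element. -/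
def HasWeight (c : K) (u : Coord K m) : Prop :=
  (c = 0 ∨ u.1 = 0) ∧ (c = -1 ∨ u.2.1 = 0) ∧ (c = 1 ∨ u.2.2 = 0)

variable {K}

theorem IsPure.hasWeight {q : ZMod 2} {c : K} {u : Coord K m} (hu : IsPure K q c u) :
    HasWeight K c u := by
  cases hu <;> simp [HasWeight]

theorem IsPure.hasWeight_br {q q' : ZMod 2} {c c' : K} {u v : Coord K m}
    (hu : IsPure K q c u) (hv : IsPure K q' c' v) : HasWeight K (c + c') (coordBr K u v) := by
  cases hu <;> cases hv <;> simp [HasWeight, coordBr, rowAct]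

theorem IsPure.isHom {q : ZMod 2} {c : K} {u : Coord K m} (hu : IsPure K q c u) :
    IsHom K q (coordMat K u) := by
  intro i j
  cases hu <;> induction i using Fin.lastCases <;> induction j using Fin.lastCases <;>
    simp <;> exact fun _ => rfl

variable (K)

theorem rhoComp_coordMat (u : Coord K m) (r : Fin m) (w : Wam K m) :
    rhoComp K (coordMat K u) r w = theta K u.1 (w r) + ((r : ℕ) * u.1.trace : K) • w r
      + (if h : (r : ℕ) + 1 < m then
          ((((r : ℕ) + 1 : ℕ) : K) • wmul K u.2.1 (w ⟨(r : ℕ) + 1, h⟩)) else 0)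
      + (if _h : 0 < (r : ℕ) then ctr K (∑ j, u.2.2 j • LinearMap.proj j)
          (w ⟨(r : ℕ) - 1, lt_of_le_of_lt (Nat.sub_le _ 1) r.isLt⟩) else 0) := by
  have h₁ : blka K (coordMat K u) = u.1 := by ext; simp [blka]
  have h₂ : blkx K (coordMat K u) = u.2.1 := by ext; simp [blkx]
  have h₃ : blky K (coordMat K u) = ∑ j, u.2.2 j • LinearMap.proj j := by simp [blky]
  have h₄ : blkd K (coordMat K u) = u.1.trace := by simp [blkd]
  rw [rhoComp, h₁, h₂, h₃, h₄]
  simp only [LinearMap.add_apply]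
  congr 1
  · congr 1
    · simp [add_mul, add_smul]
    · split_ifs <;> simp
  · split_ifs <;> simp

end Coordinates

section Core

variable {m : ℕ}

theorem sg_zero : sg K 0 = 1 := by simp [sg]

theorem sg_one : sg K 1 = -1 := by simp [sg]

theorem zmod_two_cases (a : ZMod 2) : a = 0 ∨ a = 1 := by
  revert a
  decide

theorem sg_add (a b : ZMod 2) : sg K (a + b) = sg K a * sg K b := by
  have h : (1 + 1 : ZMod 2) = 0 := rfl
  rcases zmod_two_cases a with rfl | rfl <;> rcases zmod_two_cases b with rfl | rfl <;>
    simp [sg_zero, sg_one, h]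

theorem sg_mul_self (a : ZMod 2) : sg K a * sg K a = 1 := by
  rcases zmod_two_cases a with rfl | rfl <;> simp [sg_zero, sg_one]

theorem rho_apply (u : Coord K m) (w : Wam K m) (r : Fin m) :
    rho K (coordMat K u) w r = theta K u.1 (w r) + ((r : ℕ) * u.1.trace : K) • w r
      + (if h : (r : ℕ) + 1 < m then
          ((((r : ℕ) + 1 : ℕ) : K) • wmul K u.2.1 (w ⟨(r : ℕ) + 1, h⟩)) else 0)
      + (if _h : 0 < (r : ℕ) then ctr K (∑ j, u.2.2 j • LinearMap.proj j)
          (w ⟨(r : ℕ) - 1, lt_of_le_of_lt (Nat.sub_le _ 1) r.isLt⟩) else 0) :=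
  rhoComp_coordMat K u r w

theorem wmul_zero_left (w : ExtAlg K m) : wmul K 0 w = 0 := by simp [wmul]

theorem theta_zero (w : ExtAlg K m) : theta K 0 w = 0 := by simp [theta_apply]

theorem ctr_zero_left (w : ExtAlg K m) : ctr K 0 w = 0 := by simp [ctr]

theorem rho_scale {c k : K} {u : Coord K m} (hu : HasWeight K c u) (r : Fin m) (w w' : Wam K m)
    (h : ∀ s : Fin m, ((s : ℕ) + 1 + c : K) = (r : ℕ) + 1 → w s = k • w' s) :
    rho K (coordMat K u) w r = k • rho K (coordMat K u) w' r := by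
  obtain ⟨a, x, y⟩ := u
  obtain ⟨ha, hx, hy⟩ := hu
  simp only at ha hx hy
  rw [rho_apply, rho_apply, smul_add, smul_add, smul_add]
  congr 1
  · congr 1
    · rcases ha with rfl | rfl
      · rw [h r (by ring), map_smul, smul_comm k]
      · simp [theta_zero]
    · split_ifs with hr
      · rcases hx with rfl | rfl
        · rw [h ⟨r + 1, hr⟩ (by push_cast; ring), map_smul, smul_comm k]
        · simp [wmul_zero_left]
      · simp
  · split_ifs with hr
    · rcases hy with rfl | rfl
      · rw [h ⟨r - 1, _⟩ (by push_cast [Nat.cast_sub (show 1 ≤ (r : ℕ) from hr)]; ring), map_smul]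
      · simp [ctr_zero_left]
    · simp

/-- The grading element of `sl(m|1)`. -/
def gradElt (m : ℕ) : Coord K m := ((m - 1 : K)⁻¹ • 1, 0, 0)

variable {K} in
theorem sub_one_ne_zero [CharZero K] (hm : 2 ≤ m) : (m - 1 : K) ≠ 0 := by
  rw [sub_ne_zero, Nat.cast_ne_one]
  omega

theorem coordBr_gradElt [CharZero K] (hm : 2 ≤ m) {c : K} {u : Coord K m}
    (hu : HasWeight K c u) : coordBr K (gradElt K m) u = c • u := by
  have hm' := sub_one_ne_zero (K := K) hm
  have h : (m - 1 : K)⁻¹ * m = (m - 1 : K)⁻¹ + 1 := by field_simp; ring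
  obtain ⟨a, x, y⟩ := u
  obtain ⟨ha, hx, hy⟩ := hu
  simp only at ha hx hy
  refine Prod.ext ?_ (Prod.ext ?_ ?_)
  · rcases ha with rfl | rfl <;> simp [coordBr, gradElt]
  · rcases hx with rfl | rfl
    · simp [coordBr, gradElt, h, Matrix.smul_mulVec, add_smul]
    · simp [coordBr, gradElt]
  · rcases hy with rfl | rfl
    · simp [coordBr, gradElt, rowAct, h, Matrix.vecMul_smul, add_smul]
    · simp [coordBr, gradElt, rowAct]

theorem rho_gradElt [CharZero K] (hm : 2 ≤ m) {w : Wam K m} (hw : w ∈ Vsub K m) (r : Fin m) :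
    rho K (coordMat K (gradElt K m)) w r = ((r : ℕ) + 1 : K) • w r := by
  have hm' := sub_one_ne_zero (K := K) hm
  have hr : w r ∈ ⋀[K]^(m - 1 - (r : ℕ)) (Fin m → K) := hw r (Set.mem_univ r)
  rw [rho_apply]
  simp only [gradElt, theta_smul, LinearMap.smul_apply, theta_one K hr, wmul_zero_left,
    Pi.zero_apply, zero_smul, Finset.sum_const_zero, ctr_zero_left, smul_zero, dite_eq_ite,
    ite_self, add_zero, Matrix.trace_smul, Matrix.trace_one, Fintype.card_fin, smul_smul,
    ← add_smul, smul_eq_mul]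
  have h : ((m - 1 - (r : ℕ) : ℕ) : K) = m - 1 - (r : ℕ) := by
    have := r.isLt
    rw [Nat.cast_sub (by omega), Nat.cast_sub (by omega), Nat.cast_one]
  rw [h]
  congr 1
  field_simp
  ring

/-- A 2-cocycle of parity `p`, expressed in coordinates on pure elements. -/
structure IsCocycle (p : ZMod 2) (F : Coord K m →ₗ[K] Coord K m →ₗ[K] Wam K m) : Prop where
  grade : ∀ {q q' : ZMod 2} {c c' : K} {u v : Coord K m}, IsPure K q c u → IsPure K q' c' v →
    F u v ∈ Vpart K m (q + q' + p)
  skew : ∀ {q q' : ZMod 2} {c c' : K} {u v : Coord K m}, IsPure K q c u → IsPure K q' c' v →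
    F v u = -(sg K (q * q') • F u v)
  cocycle : ∀ {q q' q'' : ZMod 2} {c c' c'' : K} {u v w : Coord K m}, IsPure K q c u →
    IsPure K q' c' v → IsPure K q'' c'' w →
    sg K (p * q) • rho K (coordMat K u) (F v w)
      - sg K (q * q' + p * q') • rho K (coordMat K v) (F u w)
      + sg K ((q + q') * q'' + p * q'') • rho K (coordMat K w) (F u v)
      - F (coordBr K u v) w + sg K (q' * q'') • F (coordBr K u w) v + F u (coordBr K v w) = 0

variable {K}

theorem Vpart_le_Vsub (p : ZMod 2) : Vpart K m p ≤ Vsub K m := by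
  intro w hw r hr
  have h := hw r hr
  simp only at h
  split_ifs at h
  · exact h
  · rw [SetLike.mem_coe, Submodule.mem_bot] at h
    rw [h]
    exact zero_mem _

theorem isPure_gradElt : IsPure K 0 0 (gradElt K m) := .zero _

namespace IsCocycle

variable {p : ZMod 2} {F : Coord K m →ₗ[K] Coord K m →ₗ[K] Wam K m}

theorem mem_slot (hF : IsCocycle K p F) {q q' : ZMod 2} {c c' : K} {u v : Coord K m}
    (hu : IsPure K q c u) (hv : IsPure K q' c' v) (r : Fin m) :
    F u v r ∈ ⋀[K]^(m - 1 - (r : ℕ)) (Fin m → K) :=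
  Vpart_le_Vsub _ (hF.grade hu hv) r (Set.mem_univ r)

theorem homotopy [CharZero K] (hF : IsCocycle K p F) (hm : 2 ≤ m) {q q' : ZMod 2} {c c' : K}
    {u v : Coord K m} (hu : IsPure K q c u) (hv : IsPure K q' c' v) (r : Fin m) :
    ((r : ℕ) + 1 - (c + c') : K) • F u v r
      = sg K (p * q) • rho K (coordMat K u) (F (gradElt K m) v) r
        - sg K (q * q' + p * q') • rho K (coordMat K v) (F (gradElt K m) u) r
        - F (gradElt K m) (coordBr K u v) r := by
  have h := congrFun (hF.cocycle isPure_gradElt hu hv) r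
  rw [coordBr_gradElt K hm hu.hasWeight, coordBr_gradElt K hm hv.hasWeight] at h
  simp only [map_smul, LinearMap.smul_apply, hF.skew hu hv, Pi.add_apply, Pi.sub_apply,
    Pi.smul_apply, Pi.neg_apply, Pi.zero_apply, mul_zero, zero_mul, zero_add, sg_zero, one_smul,
    smul_neg, rho_gradElt K hm (Vpart_le_Vsub _ (hF.grade hu hv))] at h
  rw [smul_comm c', smul_smul (sg K _) (sg K _), sg_mul_self, one_smul] at h
  simp only [sub_smul, add_smul, one_smul] at h ⊢
  rw [← sub_eq_zero, ← h]
  abel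

/-- The cochain killing the part of `F` of nonzero weight, plus a correction `T` of weight zero. -/
def cobounding (F : Coord K m →ₗ[K] Coord K m →ₗ[K] Wam K m) (T : (Fin m → K) →ₗ[K] ExtAlg K m) :
    Coord K m →ₗ[K] Wam K m where
  toFun u r := ((r : ℕ) + 1 : K)⁻¹ • F (gradElt K m) (u.1, 0, 0) r
    + ((r : ℕ) + 2 : K)⁻¹ • F (gradElt K m) (0, u.2.1, 0) r
    + ((r : ℕ) : K)⁻¹ • F (gradElt K m) (0, 0, u.2.2) r
    + if (r : ℕ) = 0 then T u.2.2 else 0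
  map_add' u v := by
    have h₁ : ((u + v).1, 0, 0) = ((u.1, 0, 0) + (v.1, 0, 0) : Coord K m) := by simp
    have h₂ : (0, (u + v).2.1, 0) = ((0, u.2.1, 0) + (0, v.2.1, 0) : Coord K m) := by simp
    have h₃ : (0, 0, (u + v).2.2) = ((0, 0, u.2.2) + (0, 0, v.2.2) : Coord K m) := by simp
    funext r
    rw [h₁, h₂, h₃]
    simp only [map_add, Pi.add_apply, smul_add, Prod.snd_add]
    split_ifs <;> abel
  map_smul' c u := by
    have h₁ : ((c • u).1, 0, 0) = (c • (u.1, 0, 0) : Coord K m) := by simp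
    have h₂ : (0, (c • u).2.1, 0) = (c • (0, u.2.1, 0) : Coord K m) := by simp
    have h₃ : (0, 0, (c • u).2.2) = (c • (0, 0, u.2.2) : Coord K m) := by simp
    funext r
    rw [h₁, h₂, h₃]
    simp only [map_smul, Pi.smul_apply, smul_add, Prod.smul_snd, smul_comm _ c,
      RingHom.id_apply]
    split_ifs <;> simp

variable {T : (Fin m → K) →ₗ[K] ExtAlg K m}

theorem cobounding_apply (u : Coord K m) (r : Fin m) :
    cobounding F T u r = ((r : ℕ) + 1 : K)⁻¹ • F (gradElt K m) (u.1, 0, 0) r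
    + ((r : ℕ) + 2 : K)⁻¹ • F (gradElt K m) (0, u.2.1, 0) r
    + ((r : ℕ) : K)⁻¹ • F (gradElt K m) (0, 0, u.2.2) r
    + if (r : ℕ) = 0 then T u.2.2 else 0 := rfl

theorem cobounding_of_ne [CharZero K] {c : K} {u : Coord K m} (hu : HasWeight K c u) (r : Fin m)
    (hr : ((r : ℕ) + 1 : K) ≠ c) :
    cobounding F T u r = ((r : ℕ) + 1 - c : K)⁻¹ • F (gradElt K m) u r := by
  obtain ⟨a, x, y⟩ := u
  obtain ⟨ha, hx, hy⟩ := hu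
  simp only at ha hx hy
  have hz : ((0, 0, 0) : Coord K m) = 0 := rfl
  rw [cobounding_apply]
  by_cases h0 : c = 0
  · subst h0
    obtain rfl : x = 0 := by simpa using hx
    obtain rfl : y = 0 := by simpa using hy
    simp [hz]
  obtain rfl := ha.resolve_left h0
  by_cases h1 : c = 1
  · subst h1
    obtain rfl : x = 0 := hx.resolve_left (by
      intro h
      have : (2 : K) = 0 := by linear_combination h
      exact two_ne_zero this)
    have : (r : ℕ) ≠ 0 := fun h => hr (by simp [h])
    simp [hz, this]
  obtain rfl := hy.resolve_left h1
  rcases hx with rfl | rfl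
  · simp only [hz, map_zero, sub_neg_eq_add, add_assoc, one_add_one_eq_two]
    simp
  · simp [hz]

theorem cobounding_up [CharZero K] (y : Fin m → K) (r : Fin m) (hr : (r : ℕ) = 0) :
    cobounding F T (0, 0, y) r = T y := by
  have hz : ((0, 0, 0) : Coord K m) = 0 := rfl
  simp [cobounding_apply, hz, hr]

theorem rho_zero (a : Matrix (Fin m) (Fin m) K) (w : Wam K m) (r : Fin m) :
    rho K (coordMat K (a, 0, 0)) w r = theta K a (w r) + ((r : ℕ) * a.trace : K) • w r := by
  simp [rho_apply, wmul_zero_left, ctr_zero_left]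

theorem rho_up_first (hm : 2 ≤ m) (y : Fin m → K) (w : Wam K m) :
    rho K (coordMat K (0, 0, y)) w ⟨0, by omega⟩ = 0 := by
  simp [rho_apply, wmul_zero_left, theta_zero]

theorem rho_up_second (hm : 2 ≤ m) (y : Fin m → K) (w : Wam K m) :
    rho K (coordMat K (0, 0, y)) w ⟨1, by omega⟩
      = ctr K (∑ j, y j • LinearMap.proj j) (w ⟨0, by omega⟩) := by
  simp [rho_apply, wmul_zero_left, theta_zero]

theorem rho_down_first (hm : 2 ≤ m) (x : Fin m → K) (w : Wam K m) :
    rho K (coordMat K (0, x, 0)) w ⟨0, by omega⟩ = wmul K x (w ⟨1, by omega⟩) := by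
  simp [rho_apply, theta_zero, show 1 < m by omega]

theorem coordBr_zero_zero (a b : Matrix (Fin m) (Fin m) K) :
    coordBr K (a, 0, 0) (b, 0, 0) = (a * b - b * a, 0, 0) := by
  simp [coordBr, rowAct]

theorem coordBr_zero_up (a : Matrix (Fin m) (Fin m) K) (y : Fin m → K) :
    coordBr K (a, 0, 0) (0, 0, y) = (0, 0, rowAct K a y) := by
  simp [coordBr, rowAct]

theorem coordBr_up_zero (a : Matrix (Fin m) (Fin m) K) (y : Fin m → K) :
    coordBr K (0, 0, y) (a, 0, 0) = -(0, 0, rowAct K a y) := by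
  simp [coordBr, rowAct]

theorem coordBr_down_up (x y : Fin m → K) :
    coordBr K (0, x, 0) (0, 0, y) = (Matrix.vecMulVec x y, 0, 0) := by
  simp [coordBr, rowAct]

theorem coordBr_up_up (y y' : Fin m → K) : coordBr K (0, 0, y) (0, 0, y') = 0 := by
  simp [coordBr, rowAct]

theorem theta_vecMulVec (x y : Fin m → K) (w : ExtAlg K m) :
    theta K (Matrix.vecMulVec x y) w = wmul K x (ctr K (∑ j, y j • LinearMap.proj j) w) := by
  rw [theta_apply, wmul_eq_sum]
  simp [ctr, Matrix.vecMulVec_apply, map_sum, Finset.smul_sum, smul_smul]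

theorem rowAct_vecMulVec (x y y' : Fin m → K) :
    rowAct K (Matrix.vecMulVec x y) y' = (x ⬝ᵥ y) • y' - (y' ⬝ᵥ x) • y := by
  rw [rowAct, Matrix.trace_vecMulVec, Matrix.vecMul_vecMulVec]

theorem levi_relation (hF : IsCocycle K p F) (hm : 2 ≤ m) (a b : Matrix (Fin m) (Fin m) K)
    (y : Fin m → K) :
    theta K a (F (b, 0, 0) (0, 0, y) ⟨0, by omega⟩)
      - theta K b (F (a, 0, 0) (0, 0, y) ⟨0, by omega⟩)
      - F (a * b - b * a, 0, 0) (0, 0, y) ⟨0, by omega⟩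
      - F (b, 0, 0) (0, 0, rowAct K a y) ⟨0, by omega⟩
      + F (a, 0, 0) (0, 0, rowAct K b y) ⟨0, by omega⟩ = 0 := by
  have h := congrFun (hF.cocycle (.zero a) (.zero b) (.up y)) ⟨0, by omega⟩
  simp only [coordBr_zero_zero, coordBr_zero_up, hF.skew (.zero b) (.up _), Pi.add_apply,
    Pi.sub_apply, Pi.smul_apply, Pi.zero_apply, rho_zero, rho_up_first hm, mul_zero,
    zero_mul, add_zero, sg_zero, one_smul, Nat.cast_zero, zero_smul, smul_zero,
    ← sub_eq_add_neg] at h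
  exact h

theorem odd_relation (hF : IsCocycle K p F) (hm : 2 ≤ m) (x y y' : Fin m → K) :
    sg K p • wmul K x (F (0, 0, y) (0, 0, y') ⟨1, by omega⟩)
      = F (Matrix.vecMulVec x y, 0, 0) (0, 0, y') ⟨0, by omega⟩
        + F (Matrix.vecMulVec x y', 0, 0) (0, 0, y) ⟨0, by omega⟩ := by
  have h := congrFun (hF.cocycle (.down x) (.up y) (.up y')) ⟨0, by omega⟩
  simp only [coordBr_down_up, coordBr_up_up, map_zero, Pi.add_apply,
    Pi.sub_apply, Pi.smul_apply, Pi.neg_apply, Pi.zero_apply, rho_down_first hm, rho_up_first hm,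
    mul_one,
    add_zero, sg_one, neg_smul, one_smul, smul_zero, sub_zero] at h
  rw [← sub_eq_zero, ← h]
  abel

theorem exists_correction [CharZero K] (hF : IsCocycle K p F) (hm : 2 ≤ m) :
    ∃ T : (Fin m → K) →ₗ[K] ExtAlg K m,
      (∀ y, T y ∈ if ((m - 1 : ℕ) : ZMod 2) = 1 + p then ⋀[K]^(m - 1) (Fin m → K) else ⊥) ∧
      ∀ a y, F (a, 0, 0) (0, 0, y) ⟨0, by omega⟩ = theta K a (T y) - T (rowAct K a y) := by
  have hg (a : Matrix (Fin m) (Fin m) K) (y : Fin m → K) := by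
    simpa using hF.grade (.zero a) (.up y) ⟨0, by omega⟩ (Set.mem_univ _)
  obtain ⟨α, hα⟩ : ∃ α : Matrix (Fin m) (Fin m) K →ₗ[K] (Fin m → K) →ₗ[K] ExtAlg K m,
      ∀ a y, α a y = F (a, 0, 0) (0, 0, y) ⟨0, by omega⟩ :=
    ⟨(F.compl₁₂ (LinearMap.inl K _ _) (LinearMap.inr K _ _ ∘ₗ LinearMap.inr K _ _)).compr₂
      (LinearMap.proj ⟨0, by omega⟩), fun _ _ => rfl⟩
  split_ifs with hp
  · simp only [← hα]
    refine levi_cocycle_inner K (by omega) α (fun a y => ?_) (fun a b y => ?_) fun x y => ?_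
    · rw [hα]
      exact hF.mem_slot (.zero a) (.up y) ⟨0, by omega⟩
    · simpa only [hα] using hF.levi_relation hm a b y
    · have h := congrArg (wmul K x) (hF.odd_relation hm x y y)
      rw [map_smul, wmul_wmul_self, smul_zero, ← two_smul K, map_smul, eq_comm, ← hα] at h
      exact (smul_eq_zero.mp h).resolve_left two_ne_zero
  · refine ⟨0, by simp, fun a y => ?_⟩
    have := hg a y
    rw [if_neg hp] at this
    simpa using this

/-- The coboundary formula for `F = dψ` on a pair of elements of parities `q` and `q'`. -/
def IsCobounded (p : ZMod 2) (F : Coord K m →ₗ[K] Coord K m →ₗ[K] Wam K m)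
    (ψ : Coord K m →ₗ[K] Wam K m) (q q' : ZMod 2) (u v : Coord K m) (r : Fin m) : Prop :=
  F u v r = sg K (p * q) • rho K (coordMat K u) (ψ v) r
    - sg K (q * q' + p * q') • rho K (coordMat K v) (ψ u) r - ψ (coordBr K u v) r

theorem isCobounded_of_ne [CharZero K] (hF : IsCocycle K p F) (hm : 2 ≤ m) {q q' : ZMod 2}
    {c c' : K} {u v : Coord K m} (hu : IsPure K q c u) (hv : IsPure K q' c' v) (r : Fin m)
    (hr : ((r : ℕ) + 1 : K) ≠ c + c') : IsCobounded p F (cobounding F T) q q' u v r := by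
  have hr' : ((r : ℕ) + 1 - (c + c') : K) ≠ 0 := sub_ne_zero.mpr hr
  have h := congrArg (fun w => ((r : ℕ) + 1 - (c + c') : K)⁻¹ • w) (hF.homotopy hm hu hv r)
  simp only [inv_smul_smul₀ hr'] at h
  rw [IsCobounded, h, cobounding_of_ne (hu.hasWeight_br hv) r hr,
    rho_scale K hu.hasWeight r (cobounding F T v) (F (gradElt K m) v) fun s hs => ?_,
    rho_scale K hv.hasWeight r (cobounding F T u) (F (gradElt K m) u) fun s hs => ?_]
  · simp only [smul_sub]
    congr 2 <;> rw [smul_comm]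
  · have e : ((s : ℕ) + 1 - c : K) = (r : ℕ) + 1 - (c + c') := by linear_combination hs
    rw [cobounding_of_ne hu.hasWeight s (sub_ne_zero.mp (e ▸ hr')), e]
  · have e : ((s : ℕ) + 1 - c' : K) = (r : ℕ) + 1 - (c + c') := by linear_combination hs
    rw [cobounding_of_ne hv.hasWeight s (sub_ne_zero.mp (e ▸ hr')), e]

theorem isCobounded_zero_up [CharZero K] (hm : 2 ≤ m)
    (hT : ∀ a y, F (a, 0, 0) (0, 0, y) ⟨0, by omega⟩ = theta K a (T y) - T (rowAct K a y))
    (a : Matrix (Fin m) (Fin m) K) (y : Fin m → K) :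
    IsCobounded p F (cobounding F T) 0 1 (a, 0, 0) (0, 0, y) ⟨0, by omega⟩ := by
  rw [IsCobounded, rho_up_first hm, rho_zero, coordBr_zero_up, cobounding_up _ _ rfl,
    cobounding_up _ _ rfl, hT]
  simp [sg_zero]

theorem isCobounded_up_zero [CharZero K] (hF : IsCocycle K p F) (hm : 2 ≤ m)
    (hT : ∀ a y, F (a, 0, 0) (0, 0, y) ⟨0, by omega⟩ = theta K a (T y) - T (rowAct K a y))
    (a : Matrix (Fin m) (Fin m) K) (y : Fin m → K) :
    IsCobounded p F (cobounding F T) 1 0 (0, 0, y) (a, 0, 0) ⟨0, by omega⟩ := by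
  rw [IsCobounded, hF.skew (.zero a) (.up y), rho_up_first hm, rho_zero, coordBr_up_zero, map_neg,
    Pi.neg_apply, Pi.neg_apply, cobounding_up _ _ rfl, cobounding_up _ _ rfl, Pi.smul_apply, hT]
  simp [sg_zero, sub_eq_add_neg, add_comm]

theorem isCobounded_up_up [CharZero K] (hF : IsCocycle K p F) (hm : 2 ≤ m)
    (hTmem : ∀ y, T y ∈ ⋀[K]^(m - 1) (Fin m → K))
    (hT : ∀ a y, F (a, 0, 0) (0, 0, y) ⟨0, by omega⟩ = theta K a (T y) - T (rowAct K a y))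
    (y y' : Fin m → K) :
    IsCobounded p F (cobounding F T) 1 1 (0, 0, y) (0, 0, y') ⟨1, by omega⟩ := by
  have hc (y y' : Fin m → K) : ctr K (∑ j, y j • LinearMap.proj j) (T y') ∈
      ⋀[K]^(m - 1 - 1) (Fin m → K) :=
    ctr_mem K _ (by rw [Nat.sub_add_cancel (by omega)]; exact hTmem y')
  rw [IsCobounded, rho_up_second hm, rho_up_second hm, coordBr_up_up, map_zero, Pi.zero_apply,
    sub_zero, cobounding_up _ _ rfl, cobounding_up _ _ rfl, mul_one, mul_one, sg_add,
    sg_one, ← sub_eq_zero]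
  refine eq_zero_of_wmul_eq_zero K (show m - 1 - 1 < m by omega) (sub_mem
    (hF.mem_slot (.up y) (.up y') ⟨1, by omega⟩) (sub_mem (Submodule.smul_mem _ _ (hc _ _))
      (Submodule.smul_mem _ _ (hc _ _)))) fun x => ?_
  have h := congrArg (fun w => sg K p • w) (hF.odd_relation hm x y y')
  simp only [smul_smul, sg_mul_self, one_smul, hT, rowAct_vecMulVec, theta_vecMulVec, map_sub,
    map_smul] at h
  simp only [map_sub, map_smul, h, dotProduct_comm x]
  module

theorem isCobounded [CharZero K] (hF : IsCocycle K p F) (hm : 2 ≤ m)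
    (hTmem : ∀ y, T y ∈ ⋀[K]^(m - 1) (Fin m → K))
    (hT : ∀ a y, F (a, 0, 0) (0, 0, y) ⟨0, by omega⟩ = theta K a (T y) - T (rowAct K a y))
    {q q' : ZMod 2} {c c' : K} {u v : Coord K m} (hu : IsPure K q c u) (hv : IsPure K q' c' v)
    (r : Fin m) : IsCobounded p F (cobounding F T) q q' u v r := by
  by_cases hr : ((r : ℕ) + 1 : K) = c + c'
  swap
  · exact hF.isCobounded_of_ne hm hu hv r hr
  have hn (k : ℕ) (e : ((r : ℕ) + 1 + k : K) = 0) : False := by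
    have e' : (((r : ℕ) + 1 + k : ℕ) : K) = 0 := by push_cast; exact e
    rw [Nat.cast_eq_zero] at e'
    omega
  have hs (k : ℕ) (hk : k < m) (e : ((r : ℕ) : K) = k) : r = ⟨k, hk⟩ :=
    Fin.ext (Nat.cast_injective e)
  cases hu with
  | zero a =>
    cases hv with
    | zero b => exact (hn 0 (by push_cast; linear_combination hr)).elim
    | up y =>
      rw [hs 0 (by omega) (by push_cast; linear_combination hr)]
      exact isCobounded_zero_up hm hT a y
    | down x => exact (hn 1 (by push_cast; linear_combination hr)).elim
  | up y =>
    cases hv with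
    | zero a =>
      rw [hs 0 (by omega) (by push_cast; linear_combination hr)]
      exact hF.isCobounded_up_zero hm hT a y
    | up y' =>
      rw [hs 1 (by omega) (by push_cast; linear_combination hr)]
      exact hF.isCobounded_up_up hm hTmem hT y y'
    | down x => exact (hn 0 (by push_cast; linear_combination hr)).elim
  | down x =>
    cases hv with
    | zero a => exact (hn 1 (by push_cast; linear_combination hr)).elim
    | up y => exact (hn 0 (by push_cast; linear_combination hr)).elim
    | down x' => exact (hn 2 (by push_cast; linear_combination hr)).elim

theorem cobounding_mem [CharZero K] (hF : IsCocycle K p F)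
    (hT : ∀ y, T y ∈ if ((m - 1 : ℕ) : ZMod 2) = 1 + p then ⋀[K]^(m - 1) (Fin m → K) else ⊥)
    {q : ZMod 2} {c : K} {u : Coord K m} (hu : IsPure K q c u) :
    cobounding F T u ∈ Vpart K m (q + p) := by
  have hz : ((0, 0, 0) : Coord K m) = 0 := rfl
  intro r _
  have hg := hF.grade isPure_gradElt hu r (Set.mem_univ r)
  rw [zero_add] at hg
  rw [cobounding_apply]
  cases hu with
  | zero a => simpa [hz] using Submodule.smul_mem _ _ hg
  | down x => simpa [hz] using Submodule.smul_mem _ _ hg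
  | up y =>
    simp only [hz, map_zero, Pi.zero_apply, smul_zero, zero_add]
    refine add_mem (Submodule.smul_mem _ _ hg) ?_
    by_cases hr : (r : ℕ) = 0
    · rw [if_pos hr]
      simpa only [hr, Nat.sub_zero] using hT y
    · rw [if_neg hr]
      exact zero_mem _

end IsCocycle

theorem pure_induction {q : ZMod 2} {A : ↥(sl K m 1)} (hA : IsHom K q (A : gl K m 1))
    {P : Coord K m → Prop} (hpure : ∀ c u, IsPure K q c u → P u)
    (hadd : ∀ u v, P u → P v → P (u + v)) : P (toCoord K A) := by
  rcases zmod_two_cases q with rfl | rfl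
  · have h : toCoord K A = ((toCoord K A).1, 0, 0) := by
      refine Prod.ext rfl (Prod.ext (funext fun i => ?_) (funext fun i => ?_))
      · by_contra h
        simpa using hA (Fin.castSucc i) (Fin.last m) h
      · by_contra h
        simpa using hA (Fin.last m) (Fin.castSucc i) h
    rw [h]
    exact hpure _ _ (.zero _)
  · have h : toCoord K A = (0, (toCoord K A).2.1, 0) + (0, 0, (toCoord K A).2.2) := by
      refine Prod.ext (Matrix.ext fun i j => ?_) (by simp)
      by_contra h
      simpa using hA (Fin.castSucc i) (Fin.castSucc j) (by simpa [toCoord_fst] using h)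
    rw [h]
    exact hadd _ _ (hpure _ _ (.down _)) (hpure _ _ (.up _))

theorem coordBr_add_left (u u' v : Coord K m) :
    coordBr K (u + u') v = coordBr K u v + coordBr K u' v := by
  refine Prod.ext ?_ (Prod.ext ?_ ?_)
  · simp [coordBr, add_mul, mul_add, Matrix.add_vecMulVec, Matrix.vecMulVec_add]
    abel
  · simp [coordBr, Matrix.add_mulVec, Matrix.mulVec_add, add_smul]
    abel
  · simp [coordBr, rowAct, Matrix.add_vecMul, Matrix.vecMul_add, add_smul]
    abel

theorem coordBr_add_right (u v v' : Coord K m) :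
    coordBr K u (v + v') = coordBr K u v + coordBr K u v' := by
  refine Prod.ext ?_ (Prod.ext ?_ ?_)
  · simp [coordBr, add_mul, mul_add, Matrix.add_vecMulVec, Matrix.vecMulVec_add]
    abel
  · simp [coordBr, Matrix.add_mulVec, Matrix.mulVec_add, add_smul]
    abel
  · simp [coordBr, rowAct, Matrix.add_vecMul, Matrix.vecMul_add, add_smul]
    abel

theorem rho_add (u v : Coord K m) (w : Wam K m) (r : Fin m) :
    rho K (coordMat K (u + v)) w r = rho K (coordMat K u) w r + rho K (coordMat K v) w r := by
  simp only [rho_apply, Prod.fst_add, Prod.snd_add, theta_add, wmul_add_left, Pi.add_apply,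
    add_smul, Finset.sum_add_distrib, Matrix.trace_add, mul_add, LinearMap.add_apply, smul_add,
    ctr, map_add]
  split_ifs <;> abel

theorem IsCocycle.IsCobounded.add_left {p q q' : ZMod 2}
    {F : Coord K m →ₗ[K] Coord K m →ₗ[K] Wam K m} {ψ : Coord K m →ₗ[K] Wam K m}
    {u u' v : Coord K m} {r : Fin m} (h : IsCobounded p F ψ q q' u v r)
    (h' : IsCobounded p F ψ q q' u' v r) : IsCobounded p F ψ q q' (u + u') v r := by
  simp only [IsCobounded, coordBr_add_left, rho_add, map_add, Pi.add_apply, smul_add,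
    LinearMap.add_apply] at h h' ⊢
  rw [h, h']
  abel

theorem IsCocycle.IsCobounded.add_right {p q q' : ZMod 2}
    {F : Coord K m →ₗ[K] Coord K m →ₗ[K] Wam K m} {ψ : Coord K m →ₗ[K] Wam K m}
    {u v v' : Coord K m} {r : Fin m} (h : IsCobounded p F ψ q q' u v r)
    (h' : IsCobounded p F ψ q q' u v' r) : IsCobounded p F ψ q q' u (v + v') r := by
  simp only [IsCobounded, coordBr_add_right, rho_add, map_add, Pi.add_apply, smul_add] at h h' ⊢
  rw [h, h']
  abel

theorem isCocycle_of_eq {p : ZMod 2} {f : ↥(sl K m 1) →ₗ[K] ↥(sl K m 1) →ₗ[K] Wam K m}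
    (hgrade : ∀ (pA pB : ZMod 2) (A B : ↥(sl K m 1)),
      IsHom K pA (A : gl K m 1) → IsHom K pB (B : gl K m 1) →
      f A B ∈ Vpart K m (pA + pB + p))
    (hskew : ∀ (pA pB : ZMod 2) (A B : ↥(sl K m 1)),
      IsHom K pA (A : gl K m 1) → IsHom K pB (B : gl K m 1) →
      f B A = -(sg K (pA * pB) • f A B))
    (hcocycle : ∀ (pA pB pC : ZMod 2) (A B C AB AC BC : ↥(sl K m 1)),
      IsHom K pA (A : gl K m 1) → IsHom K pB (B : gl K m 1) → IsHom K pC (C : gl K m 1) →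
      (AB : gl K m 1) = sbr K ↑A ↑B → (AC : gl K m 1) = sbr K ↑A ↑C →
      (BC : gl K m 1) = sbr K ↑B ↑C →
      sg K (p * pA) • rho K (A : gl K m 1) (f B C)
        - sg K (pA * pB + p * pB) • rho K (B : gl K m 1) (f A C)
        + sg K ((pA + pB) * pC + p * pC) • rho K (C : gl K m 1) (f A B)
        - f AB C + sg K (pB * pC) • f AC B + f A BC = 0)
    {F : Coord K m →ₗ[K] Coord K m →ₗ[K] Wam K m}
    (hFf : ∀ u v, F u v = f (ofCoord K u) (ofCoord K v)) : IsCocycle K p F where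
  grade hu hv := by
    rw [hFf]
    exact hgrade _ _ _ _ hu.isHom hv.isHom
  skew hu hv := by
    rw [hFf, hFf]
    exact hskew _ _ _ _ hu.isHom hv.isHom
  cocycle {_ _ _ _ _ _ u v w} hu hv hw := by
    simp only [hFf]
    exact hcocycle _ _ _ (ofCoord K u) (ofCoord K v) (ofCoord K w) (ofCoord K (coordBr K u v))
      (ofCoord K (coordBr K u w)) (ofCoord K (coordBr K v w)) hu.isHom hv.isHom hw.isHom
      (sbr_coordMat K _ _).symm (sbr_coordMat K _ _).symm (sbr_coordMat K _ _).symm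

end Core

/-- Let `m ≥ 2` and `L = sl(m|1)`, acting on `V` via `ρ` (the realization
of the simple `L`-module with highest weight `-ε_m + ε_{m+1}`).  Then `H²(L,V) = 0`:
every 2-cocycle of `L` with coefficients in `V` is a 2-coboundary. -/
theorem second_cohomology_sl_m_1_coefficients_V
    (K : Type) [Field K] [IsAlgClosed K] [CharZero K] (m : ℕ) (hm : 2 ≤ m)
    (p : ZMod 2) (f : ↥(sl K m 1) →ₗ[K] ↥(sl K m 1) →ₗ[K] Wam K m)
    -- `f` is a 2-cochain of parity `p` with values in `V` ...
    (hgrade : ∀ (pA pB : ZMod 2) (A B : ↥(sl K m 1)),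
      IsHom K pA (A : gl K m 1) → IsHom K pB (B : gl K m 1) →
      f A B ∈ Vpart K m (pA + pB + p))
    (hskew : ∀ (pA pB : ZMod 2) (A B : ↥(sl K m 1)),
      IsHom K pA (A : gl K m 1) → IsHom K pB (B : gl K m 1) →
      f B A = -(sg K (pA * pB) • f A B))
    -- ... satisfying the 2-cocycle identity:
    (hcocycle : ∀ (pA pB pC : ZMod 2) (A B C AB AC BC : ↥(sl K m 1)),
      IsHom K pA (A : gl K m 1) → IsHom K pB (B : gl K m 1) → IsHom K pC (C : gl K m 1) →
      (AB : gl K m 1) = sbr K ↑A ↑B → (AC : gl K m 1) = sbr K ↑A ↑C →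
      (BC : gl K m 1) = sbr K ↑B ↑C →
      sg K (p * pA) • rho K (A : gl K m 1) (f B C)
        - sg K (pA * pB + p * pB) • rho K (B : gl K m 1) (f A C)
        + sg K ((pA + pB) * pC + p * pC) • rho K (C : gl K m 1) (f A B)
        - f AB C + sg K (pB * pC) • f AC B + f A BC = 0) :
    -- then `f` is a 2-coboundary:
    ∃ φ : ↥(sl K m 1) →ₗ[K] Wam K m,
      (∀ (q : ZMod 2) (A : ↥(sl K m 1)), IsHom K q (A : gl K m 1) → φ A ∈ Vpart K m (q + p)) ∧
      ∀ (pA pB : ZMod 2) (A B AB : ↥(sl K m 1)),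
        IsHom K pA (A : gl K m 1) → IsHom K pB (B : gl K m 1) →
        (AB : gl K m 1) = sbr K ↑A ↑B →
        f A B = sg K (p * pA) • rho K (A : gl K m 1) (φ B)
          - sg K (pA * pB + p * pB) • rho K (B : gl K m 1) (φ A) - φ AB := by
  obtain ⟨F, hFf⟩ : ∃ F : Coord K m →ₗ[K] Coord K m →ₗ[K] Wam K m,
      ∀ u v, F u v = f (ofCoord K u) (ofCoord K v) :=
    ⟨f.compl₁₂ (ofCoord K) (ofCoord K), fun _ _ => rfl⟩
  have hF := isCocycle_of_eq hgrade hskew hcocycle hFf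
  obtain ⟨T, hTmem, hT⟩ := hF.exists_correction hm
  have hTmem' (y : Fin m → K) : T y ∈ ⋀[K]^(m - 1) (Fin m → K) := by
    have h := hTmem y
    split_ifs at h
    · exact h
    · rw [(Submodule.mem_bot K).mp h]
      exact zero_mem _
  refine ⟨IsCocycle.cobounding F T ∘ₗ toCoord K, fun q A hA => ?_,
    fun pA pB A B AB hA hB hAB => funext fun r => ?_⟩
  · exact pure_induction hA (P := fun u => IsCocycle.cobounding F T u ∈ Vpart K m (q + p))
      (fun c u hu => hF.cobounding_mem hTmem hu) fun u v hu hv => by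
        rw [map_add]
        exact add_mem hu hv
  · have h : IsCocycle.IsCobounded p F (IsCocycle.cobounding F T) pA pB (toCoord K A)
        (toCoord K B) r :=
      pure_induction hA
        (P := fun u => IsCocycle.IsCobounded p F (IsCocycle.cobounding F T) pA pB u (toCoord K B) r)
        (fun c u hu => pure_induction hB
          (P := fun v => IsCocycle.IsCobounded p F (IsCocycle.cobounding F T) pA pB u v r)
          (fun c' v hv => hF.isCobounded hm hTmem' hT hu hv r) fun _ _ => .add_right)
        fun _ _ => .add_left
    have hAB' : AB = ofCoord K (coordBr K (toCoord K A) (toCoord K B)) := by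
      refine Subtype.ext ?_
      rw [coe_ofCoord, ← sbr_coordMat, ← coe_ofCoord, ← coe_ofCoord, ofCoord_toCoord,
        ofCoord_toCoord, hAB]
    have hcoe (A : ↥(sl K m 1)) : coordMat K (toCoord K A) = (A : gl K m 1) := by
      rw [← coe_ofCoord, ofCoord_toCoord]
    rw [IsCocycle.IsCobounded, hcoe, hcoe, hFf, ofCoord_toCoord,
      ofCoord_toCoord] at h
    rw [h, hAB']
    simp only [LinearMap.comp_apply, toCoord_ofCoord, Pi.sub_apply, Pi.smul_apply]
end

section
/- Let m ≥ 2 and L = sl(m|1). Every super-skew-symmetric bilinear map f : L×L → 𝕂 (i.e. f(B,A) = −(−1)^{|A||B|} f(A,B) for homogeneous A,B) satisfying the cyclic cocycle identity (−1)^{|A||C|} f(⟨A,B⟩,C) + (−1)^{|B||A|} f(⟨B,C⟩,A) + (−1)^{|C||B|} f(⟨C,A⟩,B) = 0 for all homogeneous A,B,C ∈ L is of the form f(A,B) = φ(⟨A,B⟩) for some linear map φ : L → 𝕂. Equivalently, H²(sl(m|1), 𝕂) = 0 for the trivial module 𝕂. -/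
open Matrix

variable (K : Type) [Field K]

theorem gl_ext_s2 {m : ℕ} {K : Type} {A B : gl K m 1}
    (h : ∀ i j, A (finSumFinEquiv i) (finSumFinEquiv j) = B (finSumFinEquiv i) (finSumFinEquiv j)) :
    A = B := by
  ext i j
  simpa using h (finSumFinEquiv.symm i) (finSumFinEquiv.symm j)

/-- The matrix in `gl(m|1)` with the given blocks. -/
def ofBlocks {m : ℕ} (a : Matrix (Fin m) (Fin m) K) (u v : Fin m → K) (d : K) : gl K m 1 :=
  (fromBlocks a (replicateCol (Fin 1) u) (replicateRow (Fin 1) v)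
    (d • (1 : Matrix (Fin 1) (Fin 1) K))).submatrix finSumFinEquiv.symm finSumFinEquiv.symm

section Blocks

variable {m : ℕ}

theorem par_inl (i : Fin m) : par m 1 (finSumFinEquiv (Sum.inl i)) = 0 := by
  simp [par]

theorem par_inr (i : Fin 1) : par m 1 (finSumFinEquiv (Sum.inr i)) = 1 := by
  simp [par]

variable {K}

theorem evenP_ofBlocks (a : Matrix (Fin m) (Fin m) K) (u v : Fin m → K) (d : K) :
    evenP K (ofBlocks K a u v d) = ofBlocks K a 0 0 d := by
  apply gl_ext_s2
  rintro (i | i) (j | j) <;> simp only [evenP, of_apply, par_inl, par_inr] <;> simp [ofBlocks]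

theorem oddP_ofBlocks (a : Matrix (Fin m) (Fin m) K) (u v : Fin m → K) (d : K) :
    oddP K (ofBlocks K a u v d) = ofBlocks K 0 u v 0 := by
  apply gl_ext_s2
  rintro (i | i) (j | j) <;> simp only [oddP, of_apply, par_inl, par_inr] <;> simp [ofBlocks]

theorem ofBlocks_mul (a a' : Matrix (Fin m) (Fin m) K) (u v u' v' : Fin m → K) (d d' : K) :
    ofBlocks K a u v d * ofBlocks K a' u' v' d' =
      ofBlocks K (a * a' + vecMulVec u v') (a *ᵥ u' + d' • u) (v ᵥ* a' + d • v')
        (v ⬝ᵥ u' + d * d') := by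
  rw [ofBlocks, ofBlocks, submatrix_mul_equiv, fromBlocks_multiply]
  apply gl_ext_s2
  rintro (i | i) (j | j) <;>
    simp [ofBlocks, Matrix.mul_apply, vecMulVec_apply, mulVec, vecMul, dotProduct, mul_comm,
      Subsingleton.elim (α := Fin 1) _ 0]

theorem ofBlocks_add (a a' : Matrix (Fin m) (Fin m) K) (u v u' v' : Fin m → K) (d d' : K) :
    ofBlocks K a u v d + ofBlocks K a' u' v' d' =
      ofBlocks K (a + a') (u + u') (v + v') (d + d') := by
  apply gl_ext_s2
  rintro (i | i) (j | j) <;> simp [ofBlocks, add_mul]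

theorem ofBlocks_smul (c : K) (a : Matrix (Fin m) (Fin m) K) (u v : Fin m → K) (d : K) :
    c • ofBlocks K a u v d = ofBlocks K (c • a) (c • u) (c • v) (c • d) := by
  apply gl_ext_s2
  rintro (i | i) (j | j) <;> simp [ofBlocks, mul_assoc]

theorem ofBlocks_sub (a a' : Matrix (Fin m) (Fin m) K) (u v u' v' : Fin m → K) (d d' : K) :
    ofBlocks K a u v d - ofBlocks K a' u' v' d' =
      ofBlocks K (a - a') (u - u') (v - v') (d - d') := by
  apply gl_ext_s2
  rintro (i | i) (j | j) <;> simp [ofBlocks, sub_mul]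

theorem sbr_ofBlocks (a a' : Matrix (Fin m) (Fin m) K) (u v u' v' : Fin m → K) (d d' : K) :
    sbr K (ofBlocks K a u v d) (ofBlocks K a' u' v' d') =
      ofBlocks K (a * a' - a' * a + vecMulVec u v' + vecMulVec u' v)
        (a *ᵥ u' + d' • u - a' *ᵥ u - d • u') (v ᵥ* a' + d • v' - v' ᵥ* a - d' • v)
        (v ⬝ᵥ u' + v' ⬝ᵥ u) := by
  simp only [sbr, evenP_ofBlocks, oddP_ofBlocks, ofBlocks_mul, ofBlocks_add, ofBlocks_sub]
  congr 1
  · simp; abel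
  · simp
  · simp; abel
  · simp; ring

theorem str_ofBlocks (a : Matrix (Fin m) (Fin m) K) (u v : Fin m → K) (d : K) :
    str K (ofBlocks K a u v d) = a.trace - d := by
  rw [str, ← finSumFinEquiv.sum_comp, Fintype.sum_sum_type]
  simp only [par_inl, par_inr]
  simp [ofBlocks, sg, trace, sub_eq_add_neg]

theorem exists_eq_ofBlocks (A : gl K m 1) : ∃ a u v d, A = ofBlocks K a u v d := by
  refine ⟨of fun i j => A (finSumFinEquiv (Sum.inl i)) (finSumFinEquiv (Sum.inl j)),
    fun i => A (finSumFinEquiv (Sum.inl i)) (finSumFinEquiv (Sum.inr 0)),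
    fun j => A (finSumFinEquiv (Sum.inr 0)) (finSumFinEquiv (Sum.inl j)),
    A (finSumFinEquiv (Sum.inr 0)) (finSumFinEquiv (Sum.inr 0)), gl_ext_s2 ?_⟩
  rintro (i | i) (j | j) <;>
    simp [ofBlocks, Subsingleton.elim (α := Fin 1) _ 0]

theorem isHom_zero_ofBlocks (a : Matrix (Fin m) (Fin m) K) (d : K) :
    IsHom K 0 (ofBlocks K a 0 0 d) := by
  intro i j
  obtain ⟨i, rfl⟩ := finSumFinEquiv.surjective i
  obtain ⟨j, rfl⟩ := finSumFinEquiv.surjective j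
  rcases i with i | i <;> rcases j with j | j <;> simp only [par_inl, par_inr] <;>
    simp [ofBlocks]
  intros; decide

theorem isHom_one_ofBlocks (u v : Fin m → K) : IsHom K 1 (ofBlocks K 0 u v 0) := by
  intro i j
  obtain ⟨i, rfl⟩ := finSumFinEquiv.surjective i
  obtain ⟨j, rfl⟩ := finSumFinEquiv.surjective j
  rcases i with i | i <;> rcases j with j | j <;> simp only [par_inl, par_inr] <;>
    simp [ofBlocks]

end Blocks

/-- The element of `sl(m|1)` with given upper left, upper right and lower left blocks. -/
def slMkHom (m : ℕ) :
    (Matrix (Fin m) (Fin m) K × (Fin m → K) × (Fin m → K)) →ₗ[K] ↥(sl K m 1) :=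
  LinearMap.codRestrict (sl K m 1)
    { toFun := fun p => ofBlocks K p.1 p.2.1 p.2.2 p.1.trace
      map_add' := fun p q => by simp [ofBlocks_add]
      map_smul' := fun c p => by simp [ofBlocks_smul] }
    fun p => by
      change str K (ofBlocks K _ _ _ _) = 0
      rw [str_ofBlocks, sub_self]

/-- The parametrization of `sl(m|1)` by its upper left, upper right and lower left blocks. -/
noncomputable def slMk (m : ℕ) :
    (Matrix (Fin m) (Fin m) K × (Fin m → K) × (Fin m → K)) ≃ₗ[K] ↥(sl K m 1) :=
  LinearEquiv.ofBijective (slMkHom K m) <| by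
    constructor
    · rw [← LinearMap.ker_eq_bot, LinearMap.ker_eq_bot']
      rintro ⟨a, u, v⟩ h
      have h' : ofBlocks K a u v a.trace = 0 := congrArg Subtype.val h
      refine Prod.ext ?_ (Prod.ext ?_ ?_)
      · ext i j
        simpa [ofBlocks] using
          congrFun₂ h' (finSumFinEquiv (Sum.inl i)) (finSumFinEquiv (Sum.inl j))
      · ext i
        simpa [ofBlocks] using
          congrFun₂ h' (finSumFinEquiv (Sum.inl i)) (finSumFinEquiv (Sum.inr 0))
      · ext j
        simpa [ofBlocks] using
          congrFun₂ h' (finSumFinEquiv (Sum.inr 0)) (finSumFinEquiv (Sum.inl j))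
    · rintro ⟨A, hA⟩
      obtain ⟨a, u, v, d, rfl⟩ := exists_eq_ofBlocks A
      have hd : str K (ofBlocks K a u v d) = 0 := hA
      rw [str_ofBlocks, sub_eq_zero] at hd
      exact ⟨(a, u, v), Subtype.ext (by simp [slMkHom, hd])⟩

/-- The even part of `sl(m|1)`, identified with `gl(m)`. -/
noncomputable def slD (m : ℕ) : Matrix (Fin m) (Fin m) K →ₗ[K] ↥(sl K m 1) :=
  (slMk K m).toLinearMap ∘ₗ LinearMap.inl K _ _

/-- The upper right odd part of `sl(m|1)`. -/
noncomputable def slX (m : ℕ) : (Fin m → K) →ₗ[K] ↥(sl K m 1) :=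
  (slMk K m).toLinearMap ∘ₗ LinearMap.inr K _ _ ∘ₗ LinearMap.inl K _ _

/-- The lower left odd part of `sl(m|1)`. -/
noncomputable def slY (m : ℕ) : (Fin m → K) →ₗ[K] ↥(sl K m 1) :=
  (slMk K m).toLinearMap ∘ₗ LinearMap.inr K _ _ ∘ₗ LinearMap.inr K _ _

section Brackets

variable {K} {m : ℕ}

theorem coe_slMk (p : Matrix (Fin m) (Fin m) K × (Fin m → K) × (Fin m → K)) :
    (slMk K m p : gl K m 1) = ofBlocks K p.1 p.2.1 p.2.2 p.1.trace := rfl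

theorem coe_slD (a : Matrix (Fin m) (Fin m) K) :
    (slD K m a : gl K m 1) = ofBlocks K a 0 0 a.trace := rfl

theorem coe_slX (u : Fin m → K) : (slX K m u : gl K m 1) = ofBlocks K 0 u 0 0 := by
  simp [slX, coe_slMk]

theorem coe_slY (v : Fin m → K) : (slY K m v : gl K m 1) = ofBlocks K 0 0 v 0 := by
  simp [slY, coe_slMk]

theorem slMk_eq (p : Matrix (Fin m) (Fin m) K × (Fin m → K) × (Fin m → K)) :
    slMk K m p = slD K m p.1 + slX K m p.2.1 + slY K m p.2.2 := by
  simp [slD, slX, slY, ← map_add]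

theorem isHom_slD (a : Matrix (Fin m) (Fin m) K) : IsHom K 0 (slD K m a : gl K m 1) := by
  rw [coe_slD]; exact isHom_zero_ofBlocks _ _

theorem isHom_slX (u : Fin m → K) : IsHom K 1 (slX K m u : gl K m 1) := by
  rw [coe_slX]; exact isHom_one_ofBlocks _ _

theorem isHom_slY (v : Fin m → K) : IsHom K 1 (slY K m v : gl K m 1) := by
  rw [coe_slY]; exact isHom_one_ofBlocks _ _

theorem slD_sbr_slD (a b : Matrix (Fin m) (Fin m) K) :
    (slD K m (a * b - b * a) : gl K m 1) = sbr K (slD K m a) (slD K m b) := by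
  simp [-map_sub, -map_neg, coe_slD, sbr_ofBlocks, trace_mul_comm a b]

theorem slD_sbr_slX (a : Matrix (Fin m) (Fin m) K) (u : Fin m → K) :
    (slX K m (a *ᵥ u - a.trace • u) : gl K m 1) = sbr K (slD K m a) (slX K m u) := by
  simp [-map_sub, -map_neg, coe_slD, coe_slX, sbr_ofBlocks]

theorem slX_sbr_slD (a : Matrix (Fin m) (Fin m) K) (u : Fin m → K) :
    (slX K m (-(a *ᵥ u - a.trace • u)) : gl K m 1) = sbr K (slX K m u) (slD K m a) := by
  simp [-map_sub, -map_neg, coe_slD, coe_slX, sbr_ofBlocks]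

theorem slD_sbr_slY (a : Matrix (Fin m) (Fin m) K) (v : Fin m → K) :
    (slY K m (a.trace • v - v ᵥ* a) : gl K m 1) = sbr K (slD K m a) (slY K m v) := by
  simp [-map_sub, -map_neg, coe_slD, coe_slY, sbr_ofBlocks]

theorem slY_sbr_slD (a : Matrix (Fin m) (Fin m) K) (v : Fin m → K) :
    (slY K m (-(a.trace • v - v ᵥ* a)) : gl K m 1) = sbr K (slY K m v) (slD K m a) := by
  simp [-map_sub, -map_neg, coe_slD, coe_slY, sbr_ofBlocks]

theorem slX_sbr_slX (u u' : Fin m → K) :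
    ((0 : ↥(sl K m 1)) : gl K m 1) = sbr K (slX K m u) (slX K m u') := by
  rw [← map_zero (slMk K m)]
  simp [-map_zero, coe_slMk, coe_slX, sbr_ofBlocks]

theorem slY_sbr_slY (v v' : Fin m → K) :
    ((0 : ↥(sl K m 1)) : gl K m 1) = sbr K (slY K m v) (slY K m v') := by
  rw [← map_zero (slMk K m)]
  simp [-map_zero, coe_slMk, coe_slY, sbr_ofBlocks]

theorem slX_sbr_slY (u v : Fin m → K) :
    (slD K m (vecMulVec u v) : gl K m 1) = sbr K (slX K m u) (slY K m v) := by
  simp [coe_slD, coe_slX, coe_slY, sbr_ofBlocks, trace_vecMulVec, dotProduct_comm]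

/-- The bracket of `sl(m|1)` in terms of blocks. -/
theorem slMk_sbr_slMk (p q : Matrix (Fin m) (Fin m) K × (Fin m → K) × (Fin m → K)) :
    (slMk K m
      (p.1 * q.1 - q.1 * p.1 + vecMulVec p.2.1 q.2.2 + vecMulVec q.2.1 p.2.2,
        (p.1 *ᵥ q.2.1 - p.1.trace • q.2.1) - (q.1 *ᵥ p.2.1 - q.1.trace • p.2.1),
        (p.1.trace • q.2.2 - q.2.2 ᵥ* p.1) - (q.1.trace • p.2.2 - p.2.2 ᵥ* q.1)) : gl K m 1) =
      sbr K (slMk K m p) (slMk K m q) := by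
  simp only [coe_slMk, sbr_ofBlocks]
  congr 1
  · abel
  · abel
  · simp [trace_vecMulVec, trace_mul_comm p.1 q.1, dotProduct_comm, add_comm]

end Brackets

/-- Let `m ≥ 2` and `L = sl(m|1)`.  Every super-skew-symmetric bilinear map
`f : L × L → 𝕂` satisfying the cyclic cocycle identity is of the form `f(A,B) = φ(⟨A,B⟩)`
for some linear map `φ : L → 𝕂`; equivalently, `H²(sl(m|1), 𝕂) = 0` for the trivial module. -/
theorem second_cohomology_trivial_module_sl_m_1
    (K : Type) [Field K] [IsAlgClosed K] [CharZero K] (m : ℕ) (hm : 2 ≤ m)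
    (f : ↥(sl K m 1) →ₗ[K] ↥(sl K m 1) →ₗ[K] K)
    (hskew : ∀ (pA pB : ZMod 2) (A B : ↥(sl K m 1)), IsHom K pA (A : gl K m 1) → IsHom K pB (B : gl K m 1) →
      f B A = -(sg K (pA * pB) * f A B))
    (hcocycle : ∀ (pA pB pC : ZMod 2) (A B C AB BC CA : ↥(sl K m 1)),
      IsHom K pA (A : gl K m 1) → IsHom K pB (B : gl K m 1) → IsHom K pC (C : gl K m 1) →
      (AB : gl K m 1) = sbr K ↑A ↑B → (BC : gl K m 1) = sbr K ↑B ↑C →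
      (CA : gl K m 1) = sbr K ↑C ↑A →
      sg K (pA * pC) * f AB C + sg K (pB * pA) * f BC A + sg K (pC * pB) * f CA B = 0) :
    ∃ φ : ↥(sl K m 1) →ₗ[K] K, ∀ (A B AB : ↥(sl K m 1)),
      (AB : gl K m 1) = sbr K ↑A ↑B → f A B = φ AB := by
  have hw : (1 : K) - m ≠ 0 := by
    rw [sub_ne_zero]
    exact_mod_cast (by omega : 1 ≠ m)
  have skew_even_left : ∀ {p a} {B : ↥(sl K m 1)}, IsHom K p (B : gl K m 1) →
      f B (slD K m a) = -f (slD K m a) B := fun {p a B} hB => by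
    simpa [sg] using hskew 0 p _ _ (isHom_slD a) hB
  have symm_odd : ∀ {A B : ↥(sl K m 1)}, IsHom K 1 (A : gl K m 1) → IsHom K 1 (B : gl K m 1) →
      f B A = f A B := fun {A B} hA hB => by
    simpa [sg] using hskew 1 1 _ _ hA hB
  -- The central element `slD 1` of the even part acts on the odd parts by nonzero scalars.
  have hZX : ∀ u, (1 : Matrix (Fin m) (Fin m) K) *ᵥ u - trace (1 : Matrix (Fin m) (Fin m) K) • u =
      ((1 : K) - m) • u := fun u => by simp [sub_smul]
  have hZY : ∀ v, trace (1 : Matrix (Fin m) (Fin m) K) • v - v ᵥ* (1 : Matrix (Fin m) (Fin m) K) =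
      (-((1 : K) - m)) • v := fun v => by simp [sub_smul]
  have hXX : ∀ u u', f (slX K m u) (slX K m u') = 0 := fun u u' => by
    have h := hcocycle 0 1 1 _ _ _ _ _ _ (isHom_slD 1) (isHom_slX u) (isHom_slX u')
      (slD_sbr_slX 1 u) (slX_sbr_slX u u') (slX_sbr_slD 1 u')
    rw [hZX, hZX, map_neg, map_smul (slX K m), map_smul (slX K m), LinearMap.map_smul₂,
      LinearMap.map_neg₂, LinearMap.map_smul₂, LinearMap.map_zero₂,
      symm_odd (isHom_slX u) (isHom_slX u')] at h
    simp only [sg, mul_zero, mul_one, one_ne_zero, if_true, if_false, smul_eq_mul] at h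
    have h2 : 2 * (1 - (m : K)) * f (slX K m u) (slX K m u') = 0 := by linear_combination h
    simpa [hw] using h2
  have hYY : ∀ u u', f (slY K m u) (slY K m u') = 0 := fun u u' => by
    have h := hcocycle 0 1 1 _ _ _ _ _ _ (isHom_slD 1) (isHom_slY u) (isHom_slY u')
      (slD_sbr_slY 1 u) (slY_sbr_slY u u') (slY_sbr_slD 1 u')
    rw [hZY, hZY, map_neg, map_smul (slY K m), map_smul (slY K m), LinearMap.map_smul₂,
      LinearMap.map_neg₂, LinearMap.map_smul₂, LinearMap.map_zero₂,
      symm_odd (isHom_slY u) (isHom_slY u')] at h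
    simp only [sg, mul_zero, mul_one, one_ne_zero, if_true, if_false, smul_eq_mul] at h
    have h2 : 2 * (1 - (m : K)) * f (slY K m u) (slY K m u') = 0 := by linear_combination -h
    simpa [hw] using h2
  have hDX : ∀ a u, (1 - (m : K)) * f (slD K m a) (slX K m u) =
      f (slD K m 1) (slX K m (a *ᵥ u - a.trace • u)) := fun a u => by
    have h := hcocycle 0 0 1 _ _ _ _ _ _ (isHom_slD 1) (isHom_slD a) (isHom_slX u)
      (slD_sbr_slD 1 a) (slD_sbr_slX a u) (slX_sbr_slD 1 u)
    rw [hZX, skew_even_left (isHom_slX _), map_neg, map_smul (slX K m), LinearMap.map_neg₂,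
      LinearMap.map_smul₂, skew_even_left (isHom_slX u), Matrix.one_mul, Matrix.mul_one,
      sub_self, map_zero,
      LinearMap.map_zero₂] at h
    simp only [sg, mul_zero, zero_mul, if_true, smul_eq_mul] at h
    linear_combination h
  have hDY : ∀ a v, (-(1 - (m : K))) * f (slD K m a) (slY K m v) =
      f (slD K m 1) (slY K m (a.trace • v - v ᵥ* a)) := fun a v => by
    have h := hcocycle 0 0 1 _ _ _ _ _ _ (isHom_slD 1) (isHom_slD a) (isHom_slY v)
      (slD_sbr_slD 1 a) (slD_sbr_slY a v) (slY_sbr_slD 1 v)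
    rw [hZY, skew_even_left (isHom_slY _), map_neg, map_smul (slY K m), LinearMap.map_neg₂,
      LinearMap.map_smul₂, skew_even_left (isHom_slY v), Matrix.one_mul, Matrix.mul_one,
      sub_self, map_zero,
      LinearMap.map_zero₂] at h
    simp only [sg, mul_zero, zero_mul, if_true, smul_eq_mul] at h
    linear_combination h
  -- The potential on the even part, which is spanned by brackets of odd elements.
  let φ₀ : Matrix (Fin m) (Fin m) K →ₗ[K] K :=
    ∑ i, f (slX K m (Pi.single i 1)) ∘ₗ slY K m ∘ₗ LinearMap.proj i
  have hφ₀ : ∀ u v, φ₀ (vecMulVec u v) = f (slX K m u) (slY K m v) := fun u v => by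
    conv_rhs => rw [pi_eq_sum_univ' u]
    simp only [φ₀, LinearMap.sum_apply, LinearMap.comp_apply, map_sum, map_smul,
      LinearMap.smul_apply]
    refine Finset.sum_congr rfl fun i _ => ?_
    rw [← map_smul, ← map_smul]
    rfl
  have hDXY : ∀ a u v, f (slD K m a) (slD K m (vecMulVec u v)) =
      φ₀ (a * vecMulVec u v - vecMulVec u v * a) := fun a u v => by
    have h := hcocycle 0 1 1 _ _ _ _ _ _ (isHom_slD a) (isHom_slX u) (isHom_slY v)
      (slD_sbr_slX a u) (slX_sbr_slY u v) (slY_sbr_slD a v)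
    rw [skew_even_left (isHom_slD _), map_neg, LinearMap.map_neg₂,
      symm_odd (isHom_slX u) (isHom_slY _)] at h
    simp only [sg, mul_zero, mul_one, one_ne_zero, if_true, if_false] at h
    rw [mul_vecMulVec, vecMulVec_mul, map_sub, hφ₀, hφ₀]
    simp only [map_sub, map_smul, LinearMap.sub_apply, LinearMap.smul_apply, smul_eq_mul] at h
    linear_combination -h
  have hDD : ∀ a b, f (slD K m a) (slD K m b) = φ₀ (a * b - b * a) := fun a b => by
    have hb : b = ∑ i, vecMulVec (Pi.single i 1) (b i) := by
      ext i j
      simp [Matrix.sum_apply, vecMulVec_apply, Pi.single_apply]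
    rw [hb, Finset.mul_sum, Finset.sum_mul, ← Finset.sum_sub_distrib]
    simp only [map_sum, hDXY]
  let ψ : Matrix (Fin m) (Fin m) K × (Fin m → K) × (Fin m → K) →ₗ[K] K :=
    φ₀.coprod (((1 - (m : K))⁻¹ • (f (slD K m 1) ∘ₗ slX K m)).coprod
      ((-(1 - (m : K)))⁻¹ • (f (slD K m 1) ∘ₗ slY K m)))
  have hψ : ∀ a u v, ψ (a, u, v) = φ₀ a + ((1 - (m : K))⁻¹ * f (slD K m 1) (slX K m u) +
      (-(1 - (m : K)))⁻¹ * f (slD K m 1) (slY K m v)) := fun a u v => rfl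
  refine ⟨ψ ∘ₗ (slMk K m).symm.toLinearMap, fun A B AB hAB => ?_⟩
  obtain ⟨⟨a, u, v⟩, rfl⟩ := (slMk K m).surjective A
  obtain ⟨⟨b, u', v'⟩, rfl⟩ := (slMk K m).surjective B
  rw [← slMk_sbr_slMk] at hAB
  obtain rfl := Subtype.ext hAB
  simp only [LinearMap.comp_apply, LinearEquiv.coe_coe, LinearEquiv.symm_apply_apply]
  rw [hψ, map_add φ₀, map_add φ₀, hφ₀, hφ₀, ← hDD, map_sub (slX K m), map_sub (slY K m),
    map_sub (f _), map_sub (f _), ← hDX, ← hDX, ← hDY, ← hDY, ← mul_sub, ← mul_sub,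
    inv_mul_cancel_left₀ hw, inv_mul_cancel_left₀ (neg_ne_zero.mpr hw), slMk_eq, slMk_eq]
  simp only [map_add, LinearMap.add_apply, hXX, hYY, skew_even_left (isHom_slX _),
    skew_even_left (isHom_slY _), symm_odd (isHom_slX _) (isHom_slY _)]
  ring
end
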